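/- arXiv:2511.02758 — 12 statements merged into one kernel-verified Lean document; each statement's English description precedes it below -/
import Mathlib

section
/- Let λ, θ ∈ (0,1], let U, V ⊆ ℂ be open sets, and let ψ : [0,∞) × V → ℂ and η : [0,∞) × U → ℂ be maps such that: (i) for each t ≥ 0, ψ(t,·) is holomorphic on V and η(t,·) is holomorphic on U, and both ψ and η are continuously differentiable in t; (ii) for every t ≥ 0 and z ∈ U one has η(t,z) ∈ V and ψ(t, η(t,z)) = z; (iii) for every t ≥ 0 and w ∈ V, ∂_t ψ(t,w) = −w ∂_w{ [(1−2λθ) − θ(1−λ)w](ψ(t,w)+1) + λθ(1−w)(ψ(t,w)+1)² }. Define S(t,z) := (1+z)η(t,z)/z for z ∈ U ∖ {0}. Then for every t ≥ 0 and z ∈ U ∖ {0}: ∂_t S(t,z) = (2λθz+1) S(t,z) − θ(1+2λz) S(t,z)² − (θ z (1+λz)/2) ∂_z( S(t,z)² ). -/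
open Metric Set Filter Topology

/-- A zero-free holomorphic function on a disk is the exponential of a holomorphic function. -/
lemma exists_differentiableOn_exp_eq_of_ball {g : ℂ → ℂ} {c : ℂ} {R : ℝ} (hR : 0 < R)
    (hg : DifferentiableOn ℂ g (ball c R)) (h0 : ∀ z ∈ ball c R, g z ≠ 0) :
    ∃ L : ℂ → ℂ, DifferentiableOn ℂ L (ball c R) ∧ ∀ z ∈ ball c R, Complex.exp (L z) = g z := by
  have hc : c ∈ ball c R := mem_ball_self hR
  obtain ⟨L, hLc, hL⟩ := (((hg.deriv isOpen_ball).div hg h0).isExactOn_ball).with_val_at c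
    (Complex.log (g c))
  refine ⟨L, fun z hz => (hL z hz).differentiableAt.differentiableWithinAt, fun z hz => ?_⟩
  have hgd : ∀ w ∈ ball c R, HasDerivAt g (deriv g w) w := fun w hw =>
    (hg.differentiableAt (isOpen_ball.mem_nhds hw)).hasDerivAt
  have hd : ∀ w ∈ ball c R, HasDerivAt (fun w => Complex.exp (L w) / g w) 0 w := by
    intro w hw
    refine (((hL w hw).cexp).fun_div (hgd w hw) (h0 w hw)).congr_deriv ?_
    rw [Pi.div_apply, mul_assoc, div_mul_cancel₀ _ (h0 w hw), sub_self, zero_div]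
  have hconst := isOpen_ball.is_const_of_deriv_eq_zero (convex_ball c R).isPreconnected
    (fun w hw => (hd w hw).differentiableAt.differentiableWithinAt)
    (fun w hw => (hd w hw).deriv) hz hc
  simp only [hLc, Complex.exp_log (h0 c hc), div_self (h0 c hc)] at hconst
  exact (div_eq_one_iff_eq (h0 z hz)).mp hconst

/-- A Harnack-type inequality for zero-free holomorphic functions bounded by one. -/
lemma norm_pow_three_le_norm_of_ne_zero {g : ℂ → ℂ} {c z : ℂ} {R : ℝ} (hR : 0 < R)
    (hg : DifferentiableOn ℂ g (ball c R)) (h0 : ∀ z ∈ ball c R, g z ≠ 0)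
    (h1 : ∀ z ∈ ball c R, ‖g z‖ ≤ 1) (hc1 : ‖g c‖ < 1) (hz : dist z c ≤ R / 2) :
    ‖g c‖ ^ 3 ≤ ‖g z‖ := by
  obtain ⟨L, hL, hLg⟩ := exists_differentiableOn_exp_eq_of_ball hR hg h0
  have hc : c ∈ ball c R := mem_ball_self hR
  have hzR : z ∈ ball c R := by rw [mem_ball]; linarith
  have hn : ∀ w ∈ ball c R, ‖g w‖ = Real.exp (L w).re := fun w hw => by
    rw [← hLg w hw, Complex.norm_exp]
  have hMpos : 0 < -(L c).re := by
    rw [hn c hc, Real.exp_lt_one_iff] at hc1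
    linarith
  have hmaps : MapsTo (fun x => x + c) (ball 0 R) (ball c R) := fun x hx => by
    simpa [dist_eq_norm] using hx
  have hBC := Complex.borelCaratheodory_zero (f := fun x => L (x + c) - L c) (M := -(L c).re)
    (R := R) (z := z - c) hMpos
    ((hL.comp (by fun_prop) hmaps).sub_const _)
    (fun x hx => by
      have := h1 _ (hmaps hx)
      rw [hn _ (hmaps hx), Real.exp_le_one_iff] at this
      simpa using this)
    hR (by simpa [dist_eq_norm] using hzR) (by simp)
  simp only [sub_add_cancel] at hBC
  rw [dist_eq_norm] at hz
  have hfrac : 2 * -(L c).re * ‖z - c‖ / (R - ‖z - c‖) ≤ 2 * -(L c).re := by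
    rw [div_le_iff₀ (by linarith)]
    exact mul_le_mul_of_nonneg_left (by linarith) (by linarith)
  have hre := (abs_le.mp (Complex.abs_re_le_norm (L z - L c))).1
  rw [Complex.sub_re] at hre
  rw [hn c hc, hn z hzR, ← Real.exp_nat_mul, Real.exp_le_exp]
  push_cast
  linarith

/-- Injective holomorphic functions have comparable variation over a small concentric circle. -/
lemma norm_sub_le_mul_norm_sub_of_injOn {f : ℂ → ℂ} {c z₁ z₂ : ℂ} {r : ℝ} (hr : 0 < r)
    (hf : DifferentiableOn ℂ f (ball c (8 * r))) (hinj : InjOn f (ball c (8 * r)))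
    (hderiv : deriv f c ≠ 0) (hz₁ : z₁ ∈ sphere c r) (hz₂ : z₂ ∈ sphere c r) :
    ‖f z₁ - f c‖ ≤ 256 * ‖f z₂ - f c‖ := by
  have hc : c ∈ ball c (8 * r) := mem_ball_self (by linarith)
  have hcb : closedBall c r ⊆ ball c (8 * r) := closedBall_subset_ball (by linarith)
  have hsb : sphere c r ⊆ ball c (8 * r) := sphere_subset_closedBall.trans hcb
  have hne : ∀ z ∈ ball c (8 * r), z ≠ c → f z ≠ f c := fun z hz h h' => h (hinj hz hc h')
  obtain ⟨p, hp, hmin⟩ := (isCompact_sphere c r).exists_isMinOn ⟨z₁, hz₁⟩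
    ((hf.continuousOn.mono hsb).sub continuousOn_const).norm (f := fun z => ‖f z - f c‖)
  have hmin' : ∀ z ∈ sphere c r, ‖f p - f c‖ ≤ ‖f z - f c‖ := fun z hz => hmin hz
  refine le_trans ?_ (mul_le_mul_of_nonneg_left (hmin' z₂ hz₂) (by norm_num))
  set m := ‖f p - f c‖ with hm
  have hpc : p ≠ c := ne_of_mem_sphere hp hr.ne'
  have hmpos : 0 < m := norm_pos_iff.mpr (sub_ne_zero.mpr (hne p (hsb hp) hpc))
  set g := dslope f c with hgdef
  have hg : DifferentiableOn ℂ g (ball c (8 * r)) :=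
    (Complex.differentiableOn_dslope (isOpen_ball.mem_nhds hc)).mpr hf
  have hgnorm : ∀ z, z ≠ c → ‖g z‖ = ‖f z - f c‖ / ‖z - c‖ := fun z hz => by
    rw [hgdef, dslope_of_ne _ hz, slope_def_field, norm_div]
  have hg0 : ∀ z ∈ ball c (8 * r), g z ≠ 0 := by
    intro z hz
    rcases eq_or_ne z c with rfl | h
    · simpa [hgdef] using hderiv
    · rw [← norm_pos_iff, hgnorm z h]
      exact div_pos (norm_pos_iff.mpr (sub_ne_zero.mpr (hne z hz h)))
        (norm_pos_iff.mpr (sub_ne_zero.mpr h))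
  have hsub : ball (f c) (m / 2) ⊆ f '' closedBall c r := by
    refine DiffContOnCl.ball_subset_image_closedBall (hf.diffContOnCl_ball hcb) hr hmin' ?_
    refine (Eventually.frequently ?_ : ∃ᶠ z in 𝓝[≠] c, f z ≠ f c).filter_mono nhdsWithin_le_nhds
    filter_upwards [self_mem_nhdsWithin, mem_nhdsWithin_of_mem_nhds (isOpen_ball.mem_nhds hc)]
      with z hz hzb using hne z hzb hz
  have hlow : ∀ z ∈ ball c (8 * r), m / (16 * r) ≤ ‖g z‖ := by
    intro z hz
    rcases lt_or_ge r ‖z - c‖ with h | h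
    · have hzc : z ≠ c := by rintro rfl; simp at h; linarith
      have hge : m / 2 ≤ ‖f z - f c‖ := by
        by_contra! hlt
        obtain ⟨y, hy, hyz⟩ := hsub (show f z ∈ ball (f c) (m / 2) by
          rwa [mem_ball, dist_eq_norm])
        rw [hinj (hcb hy) hz hyz, mem_closedBall, dist_eq_norm] at hy
        linarith
      rw [hgnorm z hzc]
      rw [mem_ball, dist_eq_norm] at hz
      calc m / (16 * r) = (m / 2) / (8 * r) := by field_simp; norm_num
        _ ≤ ‖f z - f c‖ / ‖z - c‖ := by gcongr; linarith
    · have hinvd : DifferentiableOn ℂ (fun z => (g z)⁻¹) (ball c (8 * r)) := hg.inv hg0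
      have := Complex.norm_le_of_forall_mem_frontier_norm_le isBounded_ball
        (hinvd.diffContOnCl_ball hcb) (C := r / m)
        (fun w hw => by
          rw [frontier_ball c hr.ne'] at hw
          rw [norm_inv, hgnorm w (ne_of_mem_sphere hw hr.ne'), mem_sphere_iff_norm.mp hw, inv_div]
          gcongr
          exact hmin' w hw)
        (z := z) (by rwa [closure_ball c hr.ne', mem_closedBall, dist_eq_norm])
      rw [norm_inv, inv_le_comm₀ (norm_pos_iff.mpr (hg0 z hz)) (by positivity), inv_div] at this
      refine le_trans ?_ this
      gcongr
      linarith
  have hp1 : ‖p - c‖ = r := mem_sphere_iff_norm.mp hp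
  have hz11 : ‖z₁ - c‖ = r := mem_sphere_iff_norm.mp hz₁
  have hbb : ball p (4 * r) ⊆ ball c (8 * r) := ball_subset_ball' (by
    rw [dist_eq_norm, hp1]; linarith)
  have hgp : ‖g p‖ = m / r := by rw [hgnorm p hpc, hp1]
  have hg1 : ‖g z₁‖ = ‖f z₁ - f c‖ / r := by
    rw [hgnorm z₁ (ne_of_mem_sphere hz₁ hr.ne'), hz11]
  have hnh : ∀ z, ‖((m / (16 * r) : ℝ) : ℂ) / g z‖ = m / (16 * r) / ‖g z‖ := fun z => by
    rw [norm_div, Complex.norm_real, Real.norm_of_nonneg (by positivity)]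
  have hhp : ‖((m / (16 * r) : ℝ) : ℂ) / g p‖ = 1 / 16 := by
    rw [hnh, hgp]; field_simp
  have hH := norm_pow_three_le_norm_of_ne_zero (g := fun z => ((m / (16 * r) : ℝ) : ℂ) / g z)
    (c := p) (z := z₁) (R := 4 * r) (by linarith)
    ((differentiableOn_const _).div (hg.mono hbb) fun z hz => hg0 z (hbb hz))
    (fun z hz => div_ne_zero (by
      rw [Complex.ofReal_ne_zero]; positivity) (hg0 z (hbb hz)))
    (fun z hz => by
      rw [hnh]
      exact div_le_one_of_le₀ (hlow z (hbb hz)) (norm_nonneg _))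
    (by rw [hhp]; norm_num)
    (by
      have := dist_triangle_right z₁ p c
      rw [mem_sphere.mp hz₁, mem_sphere.mp hp] at this
      linarith)
  rw [hhp, hnh, le_div_iff₀ (norm_pos_iff.mpr (hg0 z₁ (hsb hz₁))), hg1] at hH
  have h2 : (1 / 16 : ℝ) ^ 3 * (‖f z₁ - f c‖ / r) = ((1 / 16 : ℝ) ^ 3 * ‖f z₁ - f c‖) / r := by ring
  have h3 : m / (16 * r) = (m / 16) / r := by field_simp
  rw [h2, h3, div_le_div_iff_of_pos_right hr] at hH
  linarith

/-- A quantitative open mapping statement for injective holomorphic functions. -/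
lemma ball_subset_image_closedBall_of_injOn {f : ℂ → ℂ} {c z₁ : ℂ} {r : ℝ} (hr : 0 < r)
    (hf : DifferentiableOn ℂ f (ball c (8 * r))) (hinj : InjOn f (ball c (8 * r)))
    (hderiv : deriv f c ≠ 0) (hz₁ : z₁ ∈ sphere c r) :
    ball (f c) (‖f z₁ - f c‖ / 512) ⊆ f '' closedBall c r := by
  have hc : c ∈ ball c (8 * r) := mem_ball_self (by linarith)
  have hcb : closedBall c r ⊆ ball c (8 * r) := closedBall_subset_ball (by linarith)
  have := DiffContOnCl.ball_subset_image_closedBall (f := f) (ε := ‖f z₁ - f c‖ / 256)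
    (hf.diffContOnCl_ball hcb) hr
    (fun z hz => by
      rw [div_le_iff₀' (by norm_num)]
      exact norm_sub_le_mul_norm_sub_of_injOn hr hf hinj hderiv hz₁ hz)
    (by
      refine (Eventually.frequently ?_ : ∃ᶠ z in 𝓝[≠] c, f z ≠ f c).filter_mono
        nhdsWithin_le_nhds
      filter_upwards [self_mem_nhdsWithin, mem_nhdsWithin_of_mem_nhds (isOpen_ball.mem_nhds hc)]
        with z hz hzb h using hz (hinj hzb hc h))
  refine (ball_subset_ball (le_of_eq ?_)).trans this
  ring

/-- Difference quotients of uniformly bounded, pointwise convergent holomorphic functions converge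
to the derivative of the limit. -/
lemma tendsto_dslope_of_tendsto {ι : Type*} {l : Filter ι} {F : ι → ℂ → ℂ} {F₀ : ℂ → ℂ}
    {a : ι → ℂ} {w₀ : ℂ} {δ M : ℝ} (hδ : 0 < δ)
    (hF : ∀ᶠ t in l, DifferentiableOn ℂ (F t) (ball w₀ δ))
    (hM : ∀ᶠ t in l, ∀ w ∈ ball w₀ δ, ‖F t w‖ ≤ M)
    (hlim : ∀ w ∈ ball w₀ δ, Tendsto (fun t => F t w) l (𝓝 (F₀ w)))
    (hF₀ : DifferentiableAt ℂ F₀ w₀) (ha : Tendsto a l (𝓝 w₀)) :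
    Tendsto (fun t => dslope (F t) w₀ (a t)) l (𝓝 (deriv F₀ w₀)) := by
  have hw₀ : w₀ ∈ ball w₀ δ := mem_ball_self hδ
  have hball : ball w₀ δ ∈ 𝓝 w₀ := ball_mem_nhds _ hδ
  obtain ⟨K, hK⟩ : ∃ K : ℝ, ∀ᶠ t in l, ∀ z ∈ ball w₀ δ,
      dist (dslope (F t) w₀ z) (dslope (F t) w₀ w₀) ≤ K * dist z w₀ := by
    refine ⟨(2 * (2 * M / δ)) / δ, ?_⟩
    filter_upwards [hF, hM] with t ht htM z hz
    refine Complex.dist_le_div_mul_dist_of_mapsTo_ball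
      ((Complex.differentiableOn_dslope hball).mpr ht) (fun w hw => ?_) hz
    have hb : ∀ w ∈ ball w₀ δ, ‖dslope (F t) w₀ w‖ ≤ 2 * M / δ := fun w hw =>
      Complex.norm_dslope_le_div_of_mapsTo_ball ht (fun y hy => by
        rw [mem_closedBall, dist_eq_norm]
        linarith [norm_sub_le (F t y) (F t w₀), htM y hy, htM w₀ hw₀]) hw
    rw [mem_closedBall, dist_eq_norm]
    linarith [norm_sub_le (dslope (F t) w₀ w) (dslope (F t) w₀ w₀), hb w hw, hb w₀ hw₀]
  rw [Metric.tendsto_nhds]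
  intro ε hε
  have hlin : ∀ᶠ z in 𝓝 w₀, K * dist z w₀ < ε / 4 := by
    have : Tendsto (fun z => K * dist z w₀) (𝓝 w₀) (𝓝 (K * dist w₀ w₀)) :=
      (continuous_const.mul (continuous_id.dist continuous_const)).tendsto _
    rw [dist_self, mul_zero] at this
    exact this.eventually (gt_mem_nhds (by linarith))
  have hslope : ∀ᶠ z in 𝓝 w₀, dist (dslope F₀ w₀ z) (deriv F₀ w₀) < ε / 4 := by
    have := (continuousAt_dslope_same.mpr hF₀).tendsto
    rw [dslope_same] at this
    exact Metric.tendsto_nhds.mp this _ (by linarith)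
  obtain ⟨b, ⟨⟨hb1, hb2⟩, hb3⟩, hbne⟩ :=
    (((hlin.and hslope).and hball).filter_mono nhdsWithin_le_nhds |>.and
      (self_mem_nhdsWithin : {w₀}ᶜ ∈ 𝓝[≠] w₀)).exists
  have hbne : b ≠ w₀ := hbne
  have hconv : Tendsto (fun t => dslope (F t) w₀ b) l (𝓝 (dslope F₀ w₀ b)) := by
    simp only [dslope_of_ne _ hbne, slope_def_field]
    exact ((hlim b hb3).sub (hlim w₀ hw₀)).div_const _
  filter_upwards [hK, ha.eventually hlin, ha.eventually hball,
    Metric.tendsto_nhds.mp hconv (ε / 4) (by linarith)] with t hKt hat hab hbt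
  have e1 := hKt _ hab
  have e2 := hKt _ hb3
  calc dist (dslope (F t) w₀ (a t)) (deriv F₀ w₀)
      ≤ dist (dslope (F t) w₀ (a t)) (dslope (F t) w₀ w₀)
        + dist (dslope (F t) w₀ w₀) (dslope (F t) w₀ b)
        + dist (dslope (F t) w₀ b) (deriv F₀ w₀) := dist_triangle4 _ _ _ _
    _ < ε := by
      rw [dist_comm (dslope (F t) w₀ w₀)]
      linarith [dist_triangle (dslope (F t) w₀ b) (dslope F₀ w₀ b) (deriv F₀ w₀)]

lemma deriv_mul_deriv_eq_one_of_leftInverse {f φ : ℂ → ℂ} {U V : Set ℂ} (hU : IsOpen U)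
    (hV : IsOpen V) (hφ : DifferentiableOn ℂ φ V) (hf : DifferentiableOn ℂ f U)
    (hmem : MapsTo f U V) (hinv : ∀ z ∈ U, φ (f z) = z) {z : ℂ} (hz : z ∈ U) :
    deriv φ (f z) * deriv f z = 1 := by
  have h1 := (hφ.differentiableAt (hV.mem_nhds (hmem hz))).hasDerivAt.comp z
    (hf.differentiableAt (hU.mem_nhds hz)).hasDerivAt
  refine h1.unique ((hasDerivAt_id z).congr_of_eventuallyEq ?_)
  filter_upwards [hU.mem_nhds hz] with w hw using hinv w hw

/-- Differentiating `ψ t (η t z) = z` in `t`, when both maps are only separately regular. -/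
lemma deriv_time_add_eq_zero_of_leftInverse {U V : Set ℂ} (hU : IsOpen U) (hV : IsOpen V)
    {ψ η : ℝ → ℂ → ℂ} {t : ℝ}
    (hψ : ∀ s, t ≤ s → DifferentiableOn ℂ (ψ s) V)
    (hη : ∀ s, t ≤ s → DifferentiableOn ℂ (η s) U)
    (hψc : ∀ w ∈ V, ContinuousWithinAt (fun s => ψ s w) (Ioi t) t)
    (hηc : ∀ z ∈ U, ContinuousWithinAt (fun s => η s z) (Ioi t) t)
    (hmem : ∀ s, t ≤ s → MapsTo (η s) U V)
    (hinv : ∀ s, t ≤ s → ∀ z ∈ U, ψ s (η s z) = z)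
    {z P Q : ℂ} (hz : z ∈ U)
    (hP : HasDerivWithinAt (fun s => ψ s (η t z)) P (Ioi t) t)
    (hQ : HasDerivWithinAt (fun s => η s z) Q (Ioi t) t) :
    P + deriv (ψ t) (η t z) * Q = 0 := by
  obtain ⟨R, hR, hRU⟩ := Metric.isOpen_iff.mp hU z hz
  set r := R / 8 with hr
  have hrpos : 0 < r := by positivity
  have h8 : ball z (8 * r) ⊆ U := by
    rw [show 8 * r = R by rw [hr]; ring]; exact hRU
  have hcb : closedBall z r ⊆ U := (closedBall_subset_ball (by linarith)).trans h8
  have hinj : ∀ s, t ≤ s → InjOn (η s) U := fun s hs x hx y hy h => by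
    rw [← hinv s hs x hx, h, hinv s hs y hy]
  have hz₁ : z + r ∈ sphere z r := by
    simp [mem_sphere_iff_norm, abs_of_pos hrpos]
  have hz₁U : z + r ∈ U := hcb (sphere_subset_closedBall hz₁)
  have hgt : ∀ᶠ s in 𝓝[>] t, t ≤ s := by
    filter_upwards [self_mem_nhdsWithin] with s hs using le_of_lt hs
  set e := ‖η t (z + r) - η t z‖ with he
  have hepos : 0 < e := norm_pos_iff.mpr (sub_ne_zero.mpr fun h =>
    ne_of_mem_sphere hz₁ hrpos.ne' (hinj t le_rfl hz₁U hz h))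
  have hsub : ∀ᶠ s in 𝓝[>] t, ball (η t z) (e / 2048) ⊆ η s '' closedBall z r := by
    have h1 : ∀ᶠ s in 𝓝[>] t, e / 2 < ‖η s (z + r) - η s z‖ :=
      ((hηc _ hz₁U).sub (hηc z hz)).norm.eventually (lt_mem_nhds (by
        change e / 2 < e
        linarith))
    have h2 : ∀ᶠ s in 𝓝[>] t, dist (η s z) (η t z) < e / 2048 :=
      Metric.tendsto_nhds.mp (hηc z hz) _ (by positivity)
    filter_upwards [hgt, h1, h2] with s hs h1 h2
    have hd := deriv_mul_deriv_eq_one_of_leftInverse hU hV (hψ s hs) (hη s hs) (hmem s hs)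
      (hinv s hs) hz
    refine Subset.trans (ball_subset_ball' ?_) (ball_subset_image_closedBall_of_injOn hrpos
      ((hη s hs).mono h8) ((hinj s hs).mono h8) (right_ne_zero_of_mul_eq_one hd) hz₁)
    rw [dist_comm]
    linarith
  have hδ : 0 < e / 2048 := by positivity
  have hballV : ball (η t z) (e / 2048) ⊆ V := by
    obtain ⟨s, hs, hts⟩ := (hsub.and hgt).exists
    intro w hw
    obtain ⟨y, hy, rfl⟩ := hs hw
    exact hmem s hts (hcb hy)
  have hM : ∀ᶠ s in 𝓝[>] t, ∀ w ∈ ball (η t z) (e / 2048), ‖ψ s w‖ ≤ ‖z‖ + r := by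
    filter_upwards [hsub, hgt] with s hs hts w hw
    obtain ⟨y, hy, rfl⟩ := hs hw
    rw [hinv s hts y (hcb hy)]
    rw [mem_closedBall, dist_eq_norm] at hy
    linarith [norm_le_norm_add_norm_sub' y z]
  have hD := tendsto_dslope_of_tendsto (F := ψ) (F₀ := ψ t) (a := fun s => η s z) hδ
    (by filter_upwards [hgt] with s hs using (hψ s hs).mono hballV) hM
    (fun w hw => hψc w (hballV hw))
    ((hψ t le_rfl).differentiableAt (hV.mem_nhds (hmem t le_rfl hz))) (hηc z hz)
  rw [hasDerivWithinAt_iff_tendsto_slope' (by simp)] at hP hQ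
  refine tendsto_nhds_unique (hP.add (hD.mul hQ)) (tendsto_const_nhds.congr' ?_)
  filter_upwards [hgt] with s hs
  have h := sub_smul_dslope (ψ s) (η t z) (η s z)
  rw [hinv s hs z hz, smul_eq_mul] at h
  rw [slope_def_module, slope_def_module, hinv t le_rfl z hz, mul_smul_comm, ← smul_add,
    mul_comm, h]
  simp

/-- **PDE for the free S transform of the free Jacobi process.**
If `ψ t` is the shifted moment generating function of the free Jacobi process with
parameters `(lam, th)` (satisfying the stated PDE), `η t` its local inverse, and
`S t z = (1+z) η t z / z` the free S transform, then `S` satisfies the PDE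
`∂_t S = (2λθz+1)S − θ(1+2λz)S² − (θz(1+λz)/2)∂_z(S²)`. -/
theorem stmt_0 (lam th : ℝ) (hlam : lam ∈ Set.Ioc (0:ℝ) 1) (hth : th ∈ Set.Ioc (0:ℝ) 1)
    (U V : Set ℂ) (hU : IsOpen U) (hV : IsOpen V)
    (ψ η : ℝ → ℂ → ℂ)
    (hψhol : ∀ t : ℝ, 0 ≤ t → DifferentiableOn ℂ (ψ t) V)
    (hηhol : ∀ t : ℝ, 0 ≤ t → DifferentiableOn ℂ (η t) U)
    (hψC1 : ∀ w ∈ V, ContDiffOn ℝ 1 (fun t => ψ t w) (Set.Ici 0))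
    (hηC1 : ∀ z ∈ U, ContDiffOn ℝ 1 (fun t => η t z) (Set.Ici 0))
    (hmem : ∀ t : ℝ, 0 ≤ t → ∀ z ∈ U, η t z ∈ V)
    (hinv : ∀ t : ℝ, 0 ≤ t → ∀ z ∈ U, ψ t (η t z) = z)
    (hPDE : ∀ t : ℝ, 0 ≤ t → ∀ w ∈ V,
      HasDerivWithinAt (fun s => ψ s w)
        (-w * deriv (fun w' => ((1 - 2*(lam:ℂ)*(th:ℂ)) - (th:ℂ)*(1-(lam:ℂ))*w') * (ψ t w' + 1)
            + (lam:ℂ)*(th:ℂ)*(1-w') * (ψ t w' + 1)^2) w)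
        (Set.Ici 0) t)
    (S : ℝ → ℂ → ℂ)
    (hS : ∀ t z, S t z = (1+z) * η t z / z) :
    ∀ t : ℝ, 0 ≤ t → ∀ z ∈ U, z ≠ 0 →
      HasDerivWithinAt (fun s => S s z)
        ((2*(lam:ℂ)*(th:ℂ)*z + 1) * S t z - (th:ℂ)*(1+2*(lam:ℂ)*z) * (S t z)^2
          - ((th:ℂ) * z * (1 + (lam:ℂ)*z)/2) * deriv (fun z' => (S t z')^2) z)
        (Set.Ici 0) t := by
  intro t ht z hz hz0
  have hIoi : Ioi t ⊆ Ici 0 := fun s hs => ht.trans (le_of_lt hs)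
  have hwV := hmem t ht z hz
  have hψd : ∀ w ∈ V, DifferentiableAt ℂ (ψ t) w := fun w hw =>
    (hψhol t ht).differentiableAt (hV.mem_nhds hw)
  have hηd : DifferentiableAt ℂ (η t) z := (hηhol t ht).differentiableAt (hU.mem_nhds hz)
  have hQ := ((hηC1 z hz).differentiableOn one_ne_zero t ht).hasDerivWithinAt
  set Q := derivWithin (fun s => η s z) (Ici 0) t
  have hPQ := deriv_time_add_eq_zero_of_leftInverse hU hV
    (fun s hs => hψhol s (ht.trans hs)) (fun s hs => hηhol s (ht.trans hs))
    (fun w hw => ((hψC1 w hw).continuousOn t ht).mono hIoi)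
    (fun z hz => ((hηC1 z hz).continuousOn t ht).mono hIoi)
    (fun s hs => hmem s (ht.trans hs)) (fun s hs => hinv s (ht.trans hs)) hz
    ((hPDE t ht _ hwV).mono hIoi) (hQ.mono hIoi)
  have hone := deriv_mul_deriv_eq_one_of_leftInverse hU hV (hψhol t ht) (hηhol t ht)
    (hmem t ht) (hinv t ht) hz
  have hψ' := (hψd _ hwV).hasDerivAt.add_const (1 : ℂ)
  have hid := hasDerivAt_id' (η t z)
  have hflux := ((((hid.const_mul ((th:ℂ)*(1-(lam:ℂ)))).const_sub
    (1 - 2*(lam:ℂ)*(th:ℂ))).mul hψ').add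
    (((hid.const_sub 1).const_mul ((lam:ℂ)*(th:ℂ))).mul (hψ'.pow 2))).deriv
  simp only [Pi.mul_def, Pi.add_def, Pi.pow_def] at hflux
  rw [hflux, hinv t ht z hz] at hPQ
  simp only [hS]
  rw [(((((hasDerivAt_id' z).const_add 1).fun_mul hηd.hasDerivAt).fun_div
    (hasDerivAt_id' z) hz0).fun_pow 2).deriv]
  refine ((hQ.const_mul (1 + z)).div_const z).congr_deriv ?_
  generalize deriv (ψ t) (η t z) = p at *
  generalize deriv (η t) z = q at *
  generalize η t z = w at *
  have hQ' : Q = w * (1 + 2*lam*th*z - th*(1-lam)*w - 2*lam*th*(1+z)*w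
      - th*(1+z)*(1+lam*z)*q) := by
    norm_num at hPQ
    linear_combination q * hPQ + (w * ((1 - 2*lam*th) - th*(1-lam)*w + 2*lam*th*(1-w)*(1+z)) - Q) * hone
  rw [hQ', show 2 - 1 = 1 from rfl, pow_one]
  push_cast
  field_simp
  ring
end

section
/- Let λ, θ ∈ (0,1], let U ⊆ ℂ be a connected open set containing 0, and let S : U → ℂ be analytic on U and not identically zero. Assume that for every z ∈ U: (2λθz+1) S(z) − θ(1+2λz) S(z)² − θ z (1+λz) S(z) S'(z) = 0. Then S(z) = (λθz+1)/(λθz+θ) for every z ∈ U with 1+λz ≠ 0. -/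
/-- If `S` solves the linear equation `(2λθz+1) − θ(1+2λz)S − θz(1+λz)S' = 0` on a connected open
set containing `0`, then `θz(1+λz)S(z) = λθz² + z` there. -/
theorem mul_eq_of_linear_ode {a b : ℂ} {U : Set ℂ} (hU : IsOpen U) (hconn : IsPreconnected U)
    (h0 : (0:ℂ) ∈ U) {S : ℂ → ℂ} (hS : DifferentiableOn ℂ S U)
    (hlin : ∀ z ∈ U, (2*a*b*z + 1) - b*(1+2*a*z) * S z - b*z*(1+a*z) * deriv S z = 0)
    {z : ℂ} (hz : z ∈ U) : b*(z + a*z^2) * S z = a*b*z^2 + z := by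
  have hder : ∀ w ∈ U, HasDerivAt (fun w => b*(w + a*w^2) * S w - (a*b*w^2 + w)) 0 w := by
    intro w hw
    have hSw := (hS.differentiableAt (hU.mem_nhds hw)).hasDerivAt
    have hsq : HasDerivAt (fun w : ℂ => w^2) (2*w) w := by
      simpa using hasDerivAt_pow 2 w
    have h := ((((hasDerivAt_id' w).add (hsq.const_mul a)).const_mul b).mul hSw).sub
      ((hsq.const_mul (a*b)).add (hasDerivAt_id' w))
    refine h.congr_deriv ?_
    simp only [Pi.add_apply]
    linear_combination -hlin w hw
  have hconst := hU.is_const_of_deriv_eq_zero hconn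
    (fun w hw => (hder w hw).differentiableAt.differentiableWithinAt)
    (fun w hw => (hder w hw).deriv) hz h0
  refine sub_eq_zero.mp (hconst.trans ?_)
  simp

/-- **Stationary analytic solutions of the S-transform PDE of the free Jacobi process.**
Any analytic solution around the origin of the stationary equation
`(2λθz+1)S − θ(1+2λz)S² − θz(1+λz)SS' = 0` which is not identically zero on a connected
open set `U ∋ 0` coincides with `z ↦ (λθz+1)/(λθz+θ)` wherever `1+λz ≠ 0`. -/
theorem stmt_1 (lam th : ℝ) (hlam : lam ∈ Set.Ioc (0:ℝ) 1) (hth : th ∈ Set.Ioc (0:ℝ) 1)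
    (U : Set ℂ) (hU : IsOpen U) (hconn : IsConnected U) (h0 : (0:ℂ) ∈ U)
    (S : ℂ → ℂ) (hS : AnalyticOnNhd ℂ S U)
    (hne : ∃ z ∈ U, S z ≠ 0)
    (hODE : ∀ z ∈ U,
      (2*(lam:ℂ)*(th:ℂ)*z + 1) * S z - (th:ℂ)*(1+2*(lam:ℂ)*z) * (S z)^2
        - (th:ℂ)*z*(1+(lam:ℂ)*z) * S z * deriv S z = 0) :
    ∀ z ∈ U, 1 + (lam:ℂ)*z ≠ 0 →
      S z = ((lam:ℂ)*(th:ℂ)*z + 1) / ((lam:ℂ)*(th:ℂ)*z + (th:ℂ)) := by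
  have hlin : ∀ z ∈ U, (2*(lam:ℂ)*(th:ℂ)*z + 1) - (th:ℂ)*(1+2*(lam:ℂ)*z) * S z
      - (th:ℂ)*z*(1+(lam:ℂ)*z) * deriv S z = 0 := by
    have hS' := hS.deriv
    have hG : AnalyticOnNhd ℂ (fun z => (2*(lam:ℂ)*(th:ℂ)*z + 1)
        - (th:ℂ)*(1+2*(lam:ℂ)*z) * S z - (th:ℂ)*z*(1+(lam:ℂ)*z) * deriv S z) U := by
      intro z hz
      have h1 := hS z hz
      have h2 := hS' z hz
      fun_prop
    refine (hS.eq_zero_or_eq_zero_of_mul_eq_zero hG (fun z hz => ?_)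
      hconn.isPreconnected).resolve_left ?_
    · linear_combination hODE z hz
    · obtain ⟨w, hw, hSw⟩ := hne
      exact fun h => hSw (h w hw)
  intro z hz hz1
  have hth0 : (th:ℂ) ≠ 0 := by exact_mod_cast hth.1.ne'
  have hden : (lam:ℂ)*(th:ℂ)*z + (th:ℂ) ≠ 0 := by
    convert mul_ne_zero hth0 hz1 using 1
    ring
  rw [eq_div_iff hden]
  rcases eq_or_ne z 0 with rfl | hz0
  · linear_combination -hlin 0 h0
  · have h := mul_eq_of_linear_ode hU hconn.isPreconnected h0 hS.differentiableOn hlin hz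
    refine mul_left_cancel₀ hz0 ?_
    linear_combination h
end

section
/- Let a > 0 be real, set ξ(s) := ((a−1)/(a+1)) e^{as} for s ∈ ℝ, and let D := {s ∈ ℝ : ξ(s) ≠ 1}. Define z : D → ℝ by z(s) = [(1+a)ξ(s) + (a−1)]/(1 − ξ(s)). Then 0 ∈ D, z(0) = a² − 1, and z is differentiable on D with z'(s) = (1/2)((z(s)+1)² − a²) = z(s) + z(s)²/2 − (a²−1)/2 for every s ∈ D. -/
/-- **Explicit solution of the characteristic ODE** for the S-transform PDE of the
free Jacobi process with parameters `(1, 1/2)` and initial data `S₀ ≡ 1`: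
with `ξ(s) = ((a−1)/(a+1))e^{as}` and `z(s) = ((1+a)ξ(s) + (a−1))/(1 − ξ(s))` on
`D = {ξ ≠ 1}`, one has `0 ∈ D`, `z(0) = a²−1`, and
`z' = (1/2)((z+1)²−a²) = z + z²/2 − (a²−1)/2` on `D`. -/
theorem stmt_3 (a : ℝ) (ha : 0 < a)
    (ξ : ℝ → ℝ) (hξ : ∀ s, ξ s = ((a-1)/(a+1)) * Real.exp (a*s))
    (D : Set ℝ) (hD : D = {s : ℝ | ξ s ≠ 1})
    (z : ℝ → ℝ) (hz : ∀ s, z s = ((1+a) * ξ s + (a-1)) / (1 - ξ s)) :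
    (0:ℝ) ∈ D ∧ z 0 = a^2 - 1 ∧
      ∀ s ∈ D, HasDerivAt z ((1/2) * ((z s + 1)^2 - a^2)) s ∧
        (1/2) * ((z s + 1)^2 - a^2) = z s + (z s)^2/2 - (a^2 - 1)/2 := by
  have ha1 : a + 1 ≠ 0 := by positivity
  have hξ0 : ξ 0 = (a - 1) / (a + 1) := by simp [hξ]
  have h0 : 1 - ξ 0 = 2 / (a + 1) := by
    rw [hξ0]
    field_simp
    ring
  subst hD
  refine ⟨fun h => ?_, ?_, fun s hs => ⟨?_, by ring⟩⟩
  · rw [h, sub_self] at h0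
    have : 0 < 2 / (a + 1) := by positivity
    exact this.ne h0
  · rw [hz, h0, hξ0]
    field_simp
    ring
  · have hne : 1 - ξ s ≠ 0 := sub_ne_zero.mpr (Ne.symm hs)
    have hξ' : HasDerivAt ξ (a * ξ s) s := by
      rw [funext hξ]
      refine (((hasDerivAt_id s).const_mul a).exp.const_mul ((a - 1) / (a + 1))).congr_deriv ?_
      dsimp only [id]
      ring
    rw [hz s, funext hz]
    refine (((hξ'.const_mul (1 + a)).add_const (a - 1)).div
      (hξ'.const_sub 1) hne).congr_deriv ?_
    field_simp
    ring
end

section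
/- Let m ≥ 1, let u_1, …, u_m ∈ ℝ and F(X) = ∏_{i=1}^m (X − u_i) ∈ ℝ[X]. Then in ℝ[X]: X(1−X) F''(X) = m(m−1) F(X) + (m−1)(1−2X) F'(X) + ∑_{(i,j) : i ≠ j} u_i (1−u_j) · ∏_{k ∉ {i,j}} (X − u_k), where the sum runs over ordered pairs (i,j) with 1 ≤ i ≠ j ≤ m. -/
open Polynomial Finset

section

variable {ι R : Type*} [DecidableEq ι] [CommRing R]

theorem derivative_prod_X_sub_C_eq_sum (s : Finset ι) (u : ι → R) :
    derivative (∏ i ∈ s, (X - C (u i))) = ∑ i ∈ s, ∏ k ∈ s.erase i, (X - C (u k)) := by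
  simp [derivative_prod_finset]

theorem derivative_derivative_prod_X_sub_C (s : Finset ι) (u : ι → R) :
    derivative (derivative (∏ i ∈ s, (X - C (u i))))
      = ∑ i ∈ s, ∑ j ∈ s.erase i, ∏ k ∈ s \ {i, j}, (X - C (u k)) := by
  simp only [derivative_prod_X_sub_C_eq_sum, derivative_sum, sdiff_insert, sdiff_singleton_eq_erase,
    erase_right_comm]

theorem sum_sum_erase_mul_prod_sdiff_pair (s : Finset ι) (f : ι → R) :
    ∑ i ∈ s, ∑ j ∈ s.erase i, f j * ∏ k ∈ s \ {i, j}, f k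
      = ((#s : R) - 1) * ∑ i ∈ s, ∏ k ∈ s.erase i, f k := by
  rw [mul_sum]
  refine sum_congr rfl fun i hi => ?_
  have h : ∀ j ∈ s.erase i, f j * ∏ k ∈ s \ {i, j}, f k = ∏ k ∈ s.erase i, f k := fun j hj => by
    rw [← mul_prod_erase _ _ hj]
    congr 2
    grind
  rw [sum_congr rfl h, sum_const, nsmul_eq_mul, cast_card_erase_of_mem hi]

theorem sum_sum_erase_mul_prod_sdiff_pair' (s : Finset ι) (f : ι → R) :
    ∑ i ∈ s, ∑ j ∈ s.erase i, f i * ∏ k ∈ s \ {i, j}, f k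
      = ((#s : R) - 1) * ∑ i ∈ s, ∏ k ∈ s.erase i, f k := by
  rw [← sum_sum_erase_mul_prod_sdiff_pair, sum_comm' (t' := s) (s' := fun i => s.erase i) (by grind)]
  simp only [pair_comm]

theorem sum_sum_erase_mul_mul_prod_sdiff_pair (s : Finset ι) (f : ι → R) :
    ∑ i ∈ s, ∑ j ∈ s.erase i, f i * f j * ∏ k ∈ s \ {i, j}, f k
      = (#s : R) * ((#s : R) - 1) * ∏ i ∈ s, f i := by
  have h : ∀ i ∈ s, ∀ j ∈ s.erase i, f i * f j * ∏ k ∈ s \ {i, j}, f k = ∏ k ∈ s, f k :=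
    fun i hi j hj => by
      rw [← mul_prod_erase _ _ hi, ← mul_prod_erase _ _ hj, mul_assoc]
      congr 3
      grind
  have h' : ∀ i ∈ s, ∑ j ∈ s.erase i, f i * f j * ∏ k ∈ s \ {i, j}, f k
      = ((#s : R) - 1) * ∏ k ∈ s, f k := fun i hi => by
    rw [sum_congr rfl (h i hi), sum_const, nsmul_eq_mul, cast_card_erase_of_mem hi]
  rw [sum_congr rfl h', sum_const, nsmul_eq_mul, mul_assoc]

end

/-- **Second-order (interaction) polynomial identity of the frozen Jacobi dynamics:**
`X(1−X)F'' = m(m−1)F + (m−1)(1−2X)F' + ∑_{i≠j} uᵢ(1−uⱼ) ∏_{k∉{i,j}} (X−u_k)`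
where `F = ∏ᵢ (X − uᵢ)` and the sum runs over ordered pairs `(i,j)`, `i ≠ j`. -/
theorem stmt_6 (m : ℕ) (hm : 1 ≤ m) (u : Fin m → ℝ) :
    X * (1 - X) * derivative (derivative (∏ i : Fin m, (X - C (u i))))
      = C ((m : ℝ) * ((m : ℝ) - 1)) * ∏ i : Fin m, (X - C (u i))
        + C ((m : ℝ) - 1) * (1 - 2 * X) * derivative (∏ i : Fin m, (X - C (u i)))
        + ∑ i : Fin m, ∑ j ∈ univ.erase i,
            C (u i * (1 - u j)) * ∏ k ∈ univ \ {i, j}, (X - C (u k)) := by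
  have hF := sum_sum_erase_mul_mul_prod_sdiff_pair univ fun i => X - C (u i)
  have hF₁ := sum_sum_erase_mul_prod_sdiff_pair univ fun i => X - C (u i)
  have hF₂ := sum_sum_erase_mul_prod_sdiff_pair' univ fun i => X - C (u i)
  rw [← derivative_prod_X_sub_C_eq_sum] at hF₁ hF₂
  simp only [card_univ, Fintype.card_fin] at hF hF₁ hF₂
  have hsum : X * (1 - X) * derivative (derivative (∏ i : Fin m, (X - C (u i))))
      = ∑ i : Fin m, ∑ j ∈ univ.erase i,
          (X - C (u i)) * (X - C (u j)) * ∏ k ∈ univ \ {i, j}, (X - C (u k))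
        - X * ∑ i : Fin m, ∑ j ∈ univ.erase i,
          (X - C (u j)) * ∏ k ∈ univ \ {i, j}, (X - C (u k))
        + (1 - X) * ∑ i : Fin m, ∑ j ∈ univ.erase i,
          (X - C (u i)) * ∏ k ∈ univ \ {i, j}, (X - C (u k))
        + ∑ i : Fin m, ∑ j ∈ univ.erase i,
          C (u i * (1 - u j)) * ∏ k ∈ univ \ {i, j}, (X - C (u k)) := by
    rw [derivative_derivative_prod_X_sub_C]
    simp only [mul_sum, ← sum_add_distrib, ← sum_sub_distrib]
    refine sum_congr rfl fun i _ => sum_congr rfl fun j _ => ?_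
    simp only [C_mul, C_sub, C_1]
    ring
  rw [hsum, hF, hF₁, hF₂]
  simp only [C_mul, C_sub, C_1, map_natCast]
  ring
end

section
/- Let m ≥ 1, let r, s ∈ ℝ and set p = r+m, q = s+m. Let I ⊆ ℝ be an open interval and let x_1, …, x_m : I → ℝ be differentiable functions with pairwise distinct values (x_i(t) ≠ x_j(t) for all i ≠ j and all t ∈ I) solving the frozen Jacobi system with parameters (p,q). Define χ(t,x) := ∏_{j=1}^m (x − x_j(t)). Then for every t ∈ I and every x ∈ ℝ: ∂_t χ(t,x) = −x(1−x) ∂²_x χ(t,x) − [(r+1) − (r+s+2)x] ∂_x χ(t,x) − m(r+s+m+1) χ(t,x); that is, χ solves the inverse Jacobi-heat equation ∂_t χ = −(L^{(r,s)} + m(r+s+m+1)) χ. -/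
open Finset

/-- Differentiable functions `x_1, …, x_m : I → ℝ` with pairwise distinct values solve the
frozen Jacobi system with parameters `(p, q)` if
`x_j' = p − (p+q)x_j + ∑_{k≠j} [x_j(1−x_k) + x_k(1−x_j)]/(x_j−x_k)` on `I`. -/
def SolvesFrozenJacobi (m : ℕ) (p q : ℝ) (I : Set ℝ) (x : Fin m → ℝ → ℝ) : Prop :=
  (∀ t ∈ I, ∀ i j : Fin m, i ≠ j → x i t ≠ x j t) ∧
  ∀ j : Fin m, ∀ t ∈ I,
    HasDerivAt (x j)
      (p - (p+q) * x j t + ∑ k ∈ univ.erase j,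
        (x j t * (1 - x k t) + x k t * (1 - x j t)) / (x j t - x k t)) t

section Sums

variable {ι : Type*} [Fintype ι] [DecidableEq ι]

/-- Off-diagonal double sums are invariant under exchanging the two indices. -/
lemma sum_sum_erase_comm (F : ι → ι → ℝ) :
    ∑ j, ∑ k ∈ univ.erase j, F j k = ∑ j, ∑ k ∈ univ.erase j, F k j := by
  refine Finset.sum_comm' fun a b => ?_
  simp [eq_comm]

/-- Expansion of the symmetric Jacobi interaction `a(1-b) + b(1-a)`, weighted by the products with
two factors removed, in terms of the products with two, one and no factors removed. -/
lemma sum_sum_jacobi_interaction (a : ι → ℝ) (y : ℝ) :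
    ∑ j, ∑ k ∈ univ.erase j, (a j * (1 - a k) + a k * (1 - a j)) *
        ∏ l ∈ (univ.erase j).erase k, (y - a l) =
      2 * (y * (1 - y)) * ∑ j, ∑ k ∈ univ.erase j, ∏ l ∈ (univ.erase j).erase k, (y - a l)
        - 2 * (1 - 2 * y) * ((Fintype.card ι - 1) * ∑ j, ∏ k ∈ univ.erase j, (y - a k))
        - 2 * (Fintype.card ι * (Fintype.card ι - 1) * ∏ j, (y - a j)) := by
  have hcard (j : ι) : ((univ.erase j).card : ℝ) = Fintype.card ι - 1 := by
    rw [Finset.cast_card_erase_of_mem (mem_univ j), Finset.card_univ]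
  have hone : ∑ j, ∑ k ∈ univ.erase j, ∏ l ∈ univ.erase j, (y - a l) =
      (Fintype.card ι - 1) * ∑ j, ∏ k ∈ univ.erase j, (y - a k) := by
    simp_rw [sum_const, nsmul_eq_mul, hcard, mul_sum]
  have hone' : ∑ j, ∑ k ∈ univ.erase j, ∏ l ∈ univ.erase k, (y - a l) =
      (Fintype.card ι - 1) * ∑ j, ∏ k ∈ univ.erase j, (y - a k) := by
    rw [← hone, sum_sum_erase_comm]
  have hzero : ∑ j : ι, ∑ k ∈ univ.erase j, ∏ l, (y - a l) =
      Fintype.card ι * (Fintype.card ι - 1) * ∏ j, (y - a j) := by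
    simp_rw [sum_const, nsmul_eq_mul, hcard, sum_const, nsmul_eq_mul, Finset.card_univ, mul_assoc]
  have key : ∑ j, ∑ k ∈ univ.erase j, (a j * (1 - a k) + a k * (1 - a j)) *
        ∏ l ∈ (univ.erase j).erase k, (y - a l) =
      ∑ j, ∑ k ∈ univ.erase j,
        (2 * (y * (1 - y)) * ∏ l ∈ (univ.erase j).erase k, (y - a l)
          - (1 - 2 * y) * ∏ l ∈ univ.erase j, (y - a l)
          - (1 - 2 * y) * ∏ l ∈ univ.erase k, (y - a l)
          - 2 * ∏ l, (y - a l)) := by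
    refine sum_congr rfl fun j _ => sum_congr rfl fun k hk => ?_
    have hkj : j ∈ univ.erase k := mem_erase.2 ⟨(ne_of_mem_erase hk).symm, mem_univ j⟩
    rw [← mul_prod_erase univ _ (mem_univ j), ← mul_prod_erase _ _ hk,
      ← mul_prod_erase _ _ hkj, erase_right_comm (a := k)]
    ring
  rw [key]
  simp_rw [sum_sub_distrib, ← mul_sum]
  rw [hone, hone', hzero]
  ring

/-- Symmetrization removes the singular denominators `a j - a k`. -/
lemma two_mul_sum_sum_div_sub (a : ι → ℝ) (ha : Function.Injective a) (N : ι → ι → ℝ)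
    (hN : ∀ j k, N j k = N k j) (y : ℝ) :
    2 * ∑ j, ∑ k ∈ univ.erase j, N j k / (a j - a k) * ∏ l ∈ univ.erase j, (y - a l) =
      ∑ j, ∑ k ∈ univ.erase j, N j k * ∏ l ∈ (univ.erase j).erase k, (y - a l) := by
  rw [two_mul]
  nth_rewrite 2 [sum_sum_erase_comm]
  simp_rw [← sum_add_distrib]
  refine sum_congr rfl fun j _ => sum_congr rfl fun k hk => ?_
  have hkj : j ∈ univ.erase k := mem_erase.2 ⟨(ne_of_mem_erase hk).symm, mem_univ j⟩
  have h₁ : a j - a k ≠ 0 := sub_ne_zero.2 (ha.ne (ne_of_mem_erase hk).symm)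
  rw [← mul_prod_erase _ _ hk, ← mul_prod_erase _ _ hkj, erase_right_comm (a := k), hN k j,
    ← neg_sub (a j) (a k)]
  field_simp
  ring

end Sums

/-- Derivative of a monic product of linear factors. -/
lemma hasDerivAt_prod_sub {ι : Type*} [DecidableEq ι] (u : Finset ι) (a : ι → ℝ) (y : ℝ) :
    HasDerivAt (fun z => ∏ j ∈ u, (z - a j)) (∑ j ∈ u, ∏ k ∈ u.erase j, (y - a k)) y := by
  simpa using HasDerivAt.fun_finsetProd (u := u) (f := fun j z => z - a j) (f' := fun _ => 1)
    fun j _ => (hasDerivAt_id y).sub_const (a j)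

/-- **The frozen Jacobi characteristic polynomial solves the inverse Jacobi-heat equation:**
if `x_1, …, x_m` solve the frozen Jacobi system with parameters `p = r+m`, `q = s+m`, then
`χ(t,y) = ∏ⱼ(y − x_j(t))` satisfies
`∂_t χ = −y(1−y)∂²_y χ − [(r+1) − (r+s+2)y]∂_y χ − m(r+s+m+1)χ`. -/
theorem stmt_7 (m : ℕ) (hm : 1 ≤ m) (r s : ℝ) (p q : ℝ) (hp : p = r + m) (hq : q = s + m)
    (I : Set ℝ) (hI : IsOpen I) (hIint : I.OrdConnected)
    (x : Fin m → ℝ → ℝ)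
    (hdiff : ∀ j : Fin m, DifferentiableOn ℝ (x j) I)
    (hsol : SolvesFrozenJacobi m p q I x)
    (χ : ℝ → ℝ → ℝ) (hχ : ∀ t y, χ t y = ∏ j : Fin m, (y - x j t)) :
    ∀ t ∈ I, ∀ y : ℝ,
      HasDerivAt (fun τ => χ τ y)
        (-(y * (1 - y)) * deriv (deriv (χ t)) y
          - ((r+1) - (r+s+2) * y) * deriv (χ t) y
          - (m : ℝ) * (r+s+m+1) * χ t y) t := by
  intro t ht y
  have hinj : Function.Injective fun j => x j t := fun i j hij => by
    by_contra hne
    exact hsol.1 t ht i j hne hij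
  have hd₁ : deriv (χ t) = fun z => ∑ j, ∏ k ∈ univ.erase j, (z - x k t) := by
    rw [show χ t = fun z => ∏ j, (z - x j t) from funext (hχ t)]
    exact funext fun z => (hasDerivAt_prod_sub univ (fun j => x j t) z).deriv
  have hd₂ : deriv (deriv (χ t)) y =
      ∑ j, ∑ k ∈ univ.erase j, ∏ l ∈ (univ.erase j).erase k, (y - x l t) := by
    rw [hd₁]
    exact (HasDerivAt.fun_sum fun j _ =>
      hasDerivAt_prod_sub (univ.erase j) (fun k => x k t) y).deriv
  have hdt := HasDerivAt.fun_finsetProd (u := univ) (f := fun j τ => y - x j τ)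
    fun j _ => (hsol.2 j t ht).const_sub y
  rw [hd₂, hd₁, show (fun τ => χ τ y) = fun τ => ∏ j, (y - x j τ) from funext (hχ · y), hχ]
  refine hdt.congr_deriv ?_
  have hsym := two_mul_sum_sum_div_sub (fun j => x j t) hinj
    (fun j k => x j t * (1 - x k t) + x k t * (1 - x j t)) (fun j k => add_comm _ _) y
  rw [sum_sum_jacobi_interaction (fun j => x j t) y, Fintype.card_fin] at hsym
  have hlin : ∑ j, (p - (p + q) * x j t) * ∏ k ∈ univ.erase j, (y - x k t) =
      (p - (p + q) * y) * ∑ j, ∏ k ∈ univ.erase j, (y - x k t)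
        + (p + q) * (m * ∏ j, (y - x j t)) := by
    have hterm (j : Fin m) : (p - (p + q) * x j t) * ∏ k ∈ univ.erase j, (y - x k t) =
        (p - (p + q) * y) * ∏ k ∈ univ.erase j, (y - x k t)
          + (p + q) * ∏ k, (y - x k t) := by
      rw [← mul_prod_erase univ _ (mem_univ j)]
      ring
    simp_rw [hterm, sum_add_distrib, ← mul_sum, sum_const, nsmul_eq_mul, card_univ,
      Fintype.card_fin]
  have hsplit : ∑ j, (∏ k ∈ univ.erase j, (y - x k t)) •
        -(p - (p + q) * x j t + ∑ k ∈ univ.erase j,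
          (x j t * (1 - x k t) + x k t * (1 - x j t)) / (x j t - x k t)) =
      -∑ j, (p - (p + q) * x j t) * ∏ k ∈ univ.erase j, (y - x k t)
        - ∑ j, ∑ k ∈ univ.erase j, (x j t * (1 - x k t) + x k t * (1 - x j t)) /
          (x j t - x k t) * ∏ l ∈ univ.erase j, (y - x l t) := by
    rw [← sum_neg_distrib, ← sum_sub_distrib]
    refine sum_congr rfl fun j _ => ?_
    rw [← sum_mul, smul_eq_mul]
    ring
  rw [hsplit, hlin]
  subst hp hq
  linear_combination (-1 / 2) * hsym
end

section
/- Let m ∈ ℕ and let r, s ∈ ℝ satisfy r > −1, s > −1 and r+s+1 > 0. Then the polynomial identity (1−X)^m = m! · ∑_{j=0}^m [Γ(s+m+1) Γ(r+s+j+1) (r+s+2j+1)] / [(m−j)! Γ(j+s+1) Γ(r+s+m+j+2)] · Q_j^{(r,s)}(X) holds in ℝ[X]. -/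
open Polynomial Finset

/-- The Jacobi polynomial on `[0,1]`:
`Q_j^{(r,s)}(X) = ∑_{k=0}^j (−1)^k (r+s+j+1)_k (r+k+1)_{j−k} / (k!(j−k)!) · X^k`,
where `(a)_k` is the (ascending) Pochhammer symbol. -/
noncomputable def jacobiQ (r s : ℝ) (j : ℕ) : Polynomial ℝ :=
  ∑ k ∈ range (j+1),
    C ((-1:ℝ)^k * ((ascPochhammer ℝ k).eval (r+s+j+1) * (ascPochhammer ℝ (j-k)).eval (r+k+1))
        / ((k.factorial : ℝ) * ((j-k).factorial : ℝ))) * X^k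

/-- The ascending factorial with its first factor split off. -/
lemma ascPochhammer_eval_succ_left (x : ℝ) (n : ℕ) :
    (ascPochhammer ℝ (n+1)).eval x = x * (ascPochhammer ℝ n).eval (x+1) := by
  rw [ascPochhammer_succ_left]
  simp

/-- The Gamma function at a shifted positive argument. -/
lemma Gamma_add_nat_eq_ascPochhammer_mul {x : ℝ} (hx : 0 < x) (n : ℕ) :
    Real.Gamma (x+n) = (ascPochhammer ℝ n).eval x * Real.Gamma x := by
  induction n with
  | zero => simp
  | succ n ih =>
    rw [ascPochhammer_succ_eval, Nat.cast_succ, ← add_assoc,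
      Real.Gamma_add_one (by positivity), ih]
    ring

/-- The summand of the very-well-poised sum `sum_jacobiTerm`. -/
noncomputable def jacobiTerm (r s : ℝ) (n i : ℕ) : ℝ :=
  (n.choose i : ℝ) * (ascPochhammer ℝ (n-i)).eval (s+i+1) * (ascPochhammer ℝ i).eval (r+1)
    * (r+s+1+2*i) / (ascPochhammer ℝ (n+1)).eval (r+s+1+i)

/-- Partial sums of the difference of two consecutive rows of `jacobiTerm`. -/
lemma sum_jacobiTerm_succ_sub (r s : ℝ) (hrs : 0 < r+s+1) (n p : ℕ) (hp : p ≤ n) :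
    ∑ i ∈ range (p+1), (jacobiTerm r s (n+1) i - jacobiTerm r s n i)
      = -((n.choose p : ℝ) * (ascPochhammer ℝ (p+1)).eval (r+1)
          * (ascPochhammer ℝ (n-p)).eval (s+p+1)
          / (ascPochhammer ℝ (n+1)).eval (r+s+1+p+1)) := by
  induction p with
  | zero =>
    have hD := ascPochhammer_pos (n+1) (r+s+1) hrs
    have hD' := ascPochhammer_pos (n+1) (r+s+1+1) (by positivity)
    have h1 := ascPochhammer_succ_eval (n+1) (r+s+1)
    have h2 := ascPochhammer_eval_succ_left (r+s+1) (n+1)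
    have h3 : (0:ℝ) < r+s+1+((n+1:ℕ):ℝ) := by positivity
    simp only [zero_add, sum_range_one, jacobiTerm, Nat.choose_zero_right, Nat.cast_zero,
      Nat.cast_one, Nat.sub_zero, add_zero, ascPochhammer_zero, ascPochhammer_one, eval_one,
      eval_X, mul_zero, one_mul, mul_one]
    rw [h1, ascPochhammer_succ_eval n (s+1)]
    have h4 : (ascPochhammer ℝ (n+1)).eval (r+s+1+1)
        = (ascPochhammer ℝ (n+1)).eval (r+s+1) * (r+s+1+((n+1:ℕ):ℝ)) / (r+s+1) := by
      rw [eq_div_iff hrs.ne', ← h1, h2]; ring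
    rw [h4]
    have := hD.ne'
    have := h3.ne'
    have := hrs.ne'
    generalize (ascPochhammer ℝ (n+1)).eval (r+s+1) = D at *
    field_simp
    push_cast
    ring
  | succ p ih =>
    rw [sum_range_succ, ih (by omega)]
    obtain ⟨q, rfl⟩ := Nat.exists_eq_add_of_le hp
    have e1 : p+1+q+1-(p+1) = q+1 := by omega
    have e2 : p+1+q-(p+1) = q := by omega
    have e3 : p+1+q-p = q+1 := by omega
    simp only [jacobiTerm, e1, e2, e3]
    have hc1 : (((p+1+q+1).choose (p+1) : ℕ) : ℝ)
        = (p+1+q).choose p + (p+1+q).choose (p+1) := by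
      rw [Nat.choose_succ_succ]; push_cast; rfl
    have hc2 : (((p+1+q).choose (p+1) : ℕ) : ℝ)
        = (p+1+q).choose p * (q+1) / (p+1) := by
      rw [eq_div_iff (by positivity)]
      have := Nat.choose_succ_right_eq (p+1+q) p
      rw [e3] at this
      exact_mod_cast this
    rw [hc1, hc2]
    have ey : r+s+1+p+1 = r+s+1+((p+1:ℕ):ℝ) := by push_cast; ring
    have ex : s+p+1+1 = s+((p+1:ℕ):ℝ)+1 := by push_cast; ring
    rw [ascPochhammer_eval_succ_left (s+p+1) q, ex, ey, ascPochhammer_succ_eval q,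
      ascPochhammer_succ_eval (p+1) (r+1)]
    have hy : 0 < r+s+1+((p+1:ℕ):ℝ) := by positivity
    have h1 := ascPochhammer_succ_eval (p+1+q+1) (r+s+1+((p+1:ℕ):ℝ))
    have h2 := ascPochhammer_eval_succ_left (r+s+1+((p+1:ℕ):ℝ)) (p+1+q+1)
    have hD := (ascPochhammer_pos (p+1+q+1) _ hy).ne'
    have h3 : r+s+1+((p+1:ℕ):ℝ)+((p+1+q+1:ℕ):ℝ) ≠ 0 := by positivity
    have h4 : (ascPochhammer ℝ (p+1+q+1)).eval (r+s+1+((p+1:ℕ):ℝ)+1)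
        = (ascPochhammer ℝ (p+1+q+1)).eval (r+s+1+((p+1:ℕ):ℝ))
          * (r+s+1+((p+1:ℕ):ℝ)+((p+1+q+1:ℕ):ℝ)) / (r+s+1+((p+1:ℕ):ℝ)) := by
      rw [eq_div_iff hy.ne', ← h1, h2]; ring
    rw [h1, h4]
    have hy' := hy.ne'
    have hp1 : (p:ℝ)+1 ≠ 0 := by positivity
    generalize (ascPochhammer ℝ (p+1+q+1)).eval (r+s+1+((p+1:ℕ):ℝ)) = D at *
    clear h1 h2 h4 hc1 hc2 ih
    push_cast at *
    field_simp
    ring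

/-- A terminating very-well-poised summation. -/
lemma sum_jacobiTerm (r s : ℝ) (hrs : 0 < r+s+1) (n : ℕ) :
    ∑ i ∈ range (n+1), jacobiTerm r s n i = 1 := by
  induction n with
  | zero => simp [jacobiTerm, hrs.ne']
  | succ n ih =>
    have h := sum_jacobiTerm_succ_sub r s hrs n n le_rfl
    rw [sum_sub_distrib, ih, sub_eq_iff_eq_add] at h
    rw [sum_range_succ, h]
    have hy : 0 < r+s+1+n+1 := by positivity
    have hD := (ascPochhammer_pos (n+1) _ hy).ne'
    have h3 : r+s+1+n+1+((n+1:ℕ):ℝ) ≠ 0 := by positivity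
    have ey : r+s+1+((n+1:ℕ):ℝ) = r+s+1+n+1 := by push_cast; ring
    simp only [jacobiTerm, Nat.choose_self, Nat.sub_self, ascPochhammer_zero, eval_one, ey]
    rw [ascPochhammer_succ_eval (n+1) (r+s+1+n+1)]
    field_simp
    push_cast
    ring

lemma coeff_jacobiQ_of_le (r s : ℝ) {j k : ℕ} (h : k ≤ j) :
    (jacobiQ r s j).coeff k
      = (-1:ℝ)^k * ((ascPochhammer ℝ k).eval (r+s+j+1) * (ascPochhammer ℝ (j-k)).eval (r+k+1))
        / ((k.factorial : ℝ) * ((j-k).factorial : ℝ)) := by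
  simp only [jacobiQ, finsetSum_coeff, coeff_C_mul_X_pow]
  rw [sum_ite_eq, if_pos (mem_range.2 (Nat.lt_succ_of_le h))]

lemma coeff_jacobiQ_of_lt (r s : ℝ) {j k : ℕ} (h : j < k) : (jacobiQ r s j).coeff k = 0 := by
  simp only [jacobiQ, finsetSum_coeff, coeff_C_mul_X_pow]
  rw [sum_ite_eq, if_neg (by simpa using h)]

lemma coeff_one_sub_X_pow (m k : ℕ) :
    (((1 : Polynomial ℝ) - X)^m).coeff k = (-1)^k * (m.choose k : ℝ) := by
  have h : ((1 : Polynomial ℝ) - X)^m = ((1 + X)^m).comp (C (-1) * X) := by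
    simp [sub_eq_add_neg]
  rw [h, comp_C_mul_X_coeff, coeff_one_add_X_pow]
  ring

/-- **Expansion of `(1−X)^m` in the Jacobi polynomial basis:**
`(1−X)^m = m! ∑_{j=0}^m [Γ(s+m+1)Γ(r+s+j+1)(r+s+2j+1)]/[(m−j)!Γ(j+s+1)Γ(r+s+m+j+2)] Q_j^{(r,s)}`. -/
theorem stmt_8 (m : ℕ) (r s : ℝ) (hr : r > -1) (hs : s > -1) (hrs : r+s+1 > 0) :
    ((1 : Polynomial ℝ) - X)^m
      = C (m.factorial : ℝ) * ∑ j ∈ range (m+1),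
          C (Real.Gamma (s+m+1) * Real.Gamma (r+s+j+1) * (r+s+2*j+1)
              / (((m-j).factorial : ℝ) * Real.Gamma (j+s+1) * Real.Gamma (r+s+m+j+2)))
            * jacobiQ r s j := by
  ext k
  rw [coeff_one_sub_X_pow, coeff_C_mul, finsetSum_coeff]
  simp only [coeff_C_mul]
  rcases lt_or_ge m k with hk | hk
  · rw [Nat.choose_eq_zero_of_lt hk, sum_eq_zero]
    · simp
    · intro j hj
      rw [coeff_jacobiQ_of_lt r s (by rw [mem_range] at hj; omega), mul_zero]
  obtain ⟨n, rfl⟩ := Nat.exists_eq_add_of_le hk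
  rw [add_assoc, sum_range_add, sum_eq_zero (s := range k), zero_add]
  swap
  · intro j hj
    rw [coeff_jacobiQ_of_lt r s (mem_range.1 hj), mul_zero]
  have ha : 0 < (r+k)+(s+k)+1 := by
    have : (0:ℝ) ≤ k := k.cast_nonneg
    linarith
  have key : ∀ i ∈ range (n+1),
      Real.Gamma (s+(k+n:ℕ)+1) * Real.Gamma (r+s+(k+i:ℕ)+1) * (r+s+2*(k+i:ℕ)+1)
        / (((k+n-(k+i)).factorial : ℝ) * Real.Gamma ((k+i:ℕ)+s+1)
          * Real.Gamma (r+s+(k+n:ℕ)+(k+i:ℕ)+2)) * (jacobiQ r s (k+i)).coeff k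
      = (-1)^k / (k.factorial * n.factorial) * jacobiTerm (r+k) (s+k) n i := by
    intro i hi
    obtain ⟨q, rfl⟩ := Nat.exists_eq_add_of_le (Nat.lt_succ_iff.1 (mem_range.1 hi))
    have e1 : k+(i+q)-(k+i) = q := by omega
    have e2 : i+q-i = q := by omega
    have e3 : k+i-k = i := by omega
    have hk0 : (0:ℝ) ≤ k := k.cast_nonneg
    have hi0 : (0:ℝ) ≤ i := i.cast_nonneg
    have hx : 0 < s+k+i+1 := by linarith
    have hy : 0 < r+s+(k+i:ℕ)+1 := by push_cast; linarith
    have hz : 0 < r+k+(s+k)+1+i := by linarith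
    have g1 : Real.Gamma (s+(k+(i+q):ℕ)+1)
        = (ascPochhammer ℝ q).eval (s+k+i+1) * Real.Gamma (s+k+i+1) := by
      rw [← Gamma_add_nat_eq_ascPochhammer_mul hx]; congr 1; push_cast; ring
    have g2 : Real.Gamma ((k+i:ℕ)+s+1) = Real.Gamma (s+k+i+1) := by
      congr 1; push_cast; ring
    have g3 : Real.Gamma (r+k+(s+k)+1+i)
        = (ascPochhammer ℝ k).eval (r+s+(k+i:ℕ)+1) * Real.Gamma (r+s+(k+i:ℕ)+1) := by
      rw [← Gamma_add_nat_eq_ascPochhammer_mul hy]; congr 1; push_cast; ring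
    have g4 : Real.Gamma (r+s+(k+(i+q):ℕ)+(k+i:ℕ)+2)
        = (ascPochhammer ℝ (i+q+1)).eval (r+k+(s+k)+1+i) * Real.Gamma (r+k+(s+k)+1+i) := by
      rw [← Gamma_add_nat_eq_ascPochhammer_mul hz]; congr 1; push_cast; ring
    have hc : (((i+q).choose i : ℕ) : ℝ)
        = (i+q).factorial / (i.factorial * q.factorial) := by
      rw [Nat.cast_choose ℝ (Nat.le_add_right i q), e2]
    rw [coeff_jacobiQ_of_le r s (Nat.le_add_right k i), g1, g2, g4, g3]
    simp only [jacobiTerm, e1, e2, e3, hc]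
    have := (Real.Gamma_pos_of_pos hx).ne'
    have := (Real.Gamma_pos_of_pos hy).ne'
    have := (ascPochhammer_pos k _ hy).ne'
    have := (ascPochhammer_pos (i+q+1) _ hz).ne'
    have := Nat.cast_ne_zero (R := ℝ).2 (i+q).factorial_ne_zero
    have := Nat.cast_ne_zero (R := ℝ).2 i.factorial_ne_zero
    have := Nat.cast_ne_zero (R := ℝ).2 q.factorial_ne_zero
    have := Nat.cast_ne_zero (R := ℝ).2 k.factorial_ne_zero
    have el : r+s+2*((k+i:ℕ):ℝ)+1 = r+k+(s+k)+1+2*i := by push_cast; ring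
    rw [el]
    field_simp
  rw [sum_congr rfl key, ← mul_sum, sum_jacobiTerm _ _ ha,
    Nat.cast_choose ℝ (Nat.le_add_right k n), Nat.add_sub_cancel_left]
  ring
end

section
/- Let m ∈ ℕ, r, s ∈ ℝ and c_0, …, c_m ∈ ℝ. Define χ(t,x) := ∑_{j=0}^m c_j e^{−(m−j)(r+s+1+m+j)t} Q_j^{(r,s)}(x) for t, x ∈ ℝ. Then χ(0,x) = ∑_{j=0}^m c_j Q_j^{(r,s)}(x) and for all t, x ∈ ℝ: ∂_t χ(t,x) = −x(1−x) ∂²_x χ(t,x) − [(r+1) − (r+s+2)x] ∂_x χ(t,x) − m(r+s+m+1) χ(t,x). -/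
open Polynomial Finset

theorem jacobiQ_coeff (r s : ℝ) (j k : ℕ) :
    (jacobiQ r s j).coeff k = if k ≤ j then
      (-1 : ℝ) ^ k * ((ascPochhammer ℝ k).eval (r + s + j + 1) *
        (ascPochhammer ℝ (j - k)).eval (r + k + 1)) / ((k.factorial : ℝ) * ((j - k).factorial : ℝ))
      else 0 := by
  simp [jacobiQ, finsetSum_coeff, coeff_C_mul, coeff_X_pow]

theorem jacobiQ_coeff_succ (r s : ℝ) (j k : ℕ) :
    (k + 1) * (k + r + 1) * (jacobiQ r s j).coeff (k + 1)
      + (j - k) * (j + k + r + s + 1) * (jacobiQ r s j).coeff k = 0 := by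
  rw [jacobiQ_coeff, jacobiQ_coeff]
  rcases lt_trichotomy k j with h | rfl | h
  · obtain ⟨d, rfl⟩ : ∃ d, j = k + d + 1 := ⟨j - k - 1, by omega⟩
    have h₁ : k + d + 1 - (k + 1) = d := by omega
    have h₂ : k + d + 1 - k = d + 1 := by omega
    have hk : (k.factorial : ℝ) ≠ 0 := by positivity
    have hd : (d.factorial : ℝ) ≠ 0 := by positivity
    have hk' : (k : ℝ) + 1 ≠ 0 := by positivity
    have hd' : (d : ℝ) + 1 ≠ 0 := by positivity
    rw [if_pos (by omega), if_pos (by omega), h₁, h₂, ascPochhammer_succ_eval,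
      ascPochhammer_succ_left ℝ d]
    simp only [eval_mul, eval_X, eval_comp, eval_add, eval_one, Nat.factorial_succ]
    push_cast
    rw [show r + ((k : ℝ) + 1) + 1 = r + k + 1 + 1 by ring]
    field_simp
    ring
  · simp
  · simp [h.not_ge, show ¬ k + 1 ≤ j by omega]

/-- The Jacobi polynomials are eigenfunctions of the Jacobi operator. -/
theorem jacobiQ_eigenfunction (r s : ℝ) (j : ℕ) :
    X * (1 - X) * derivative (derivative (jacobiQ r s j))
      + (C (r + 1) - C (r + s + 2) * X) * derivative (jacobiQ r s j)
      = -C (j * (j + r + s + 1)) * jacobiQ r s j := by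
  have expand : ∀ p q : ℝ[X], X * (1 - X) * p + (C (r + 1) - C (r + s + 2) * X) * q
      = p * X - p * X * X + C (r + 1) * q - C (r + s + 2) * (q * X) := by
    intro p q; ring
  rw [expand, neg_mul]
  ext k
  have h := jacobiQ_coeff_succ r s j k
  rcases k with _ | _ | k <;>
  · simp only [coeff_add, coeff_sub, coeff_neg, coeff_C_mul, coeff_mul_X,
      coeff_derivative, mul_coeff_zero, coeff_C_zero, coeff_X_zero, mul_zero, zero_add] at h ⊢
    push_cast at h ⊢
    linear_combination h

/-- **The Jacobi expansion solves the inverse Jacobi-heat equation:**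
`χ(t,x) = ∑_{j=0}^m c_j e^{−(m−j)(r+s+1+m+j)t} Q_j^{(r,s)}(x)` satisfies
`χ(0,x) = ∑_j c_j Q_j^{(r,s)}(x)` and
`∂_t χ = −x(1−x)∂²_x χ − [(r+1) − (r+s+2)x]∂_x χ − m(r+s+m+1)χ`. -/
theorem stmt_9 (m : ℕ) (r s : ℝ) (c : ℕ → ℝ)
    (χ : ℝ → ℝ → ℝ)
    (hχ : ∀ t x, χ t x = ∑ j ∈ range (m+1),
      c j * Real.exp (-((m : ℝ) - j) * (r+s+1+m+j) * t) * (jacobiQ r s j).eval x) :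
    (∀ x : ℝ, χ 0 x = ∑ j ∈ range (m+1), c j * (jacobiQ r s j).eval x) ∧
    ∀ t x : ℝ,
      HasDerivAt (fun τ => χ τ x)
        (-(x * (1 - x)) * deriv (deriv (χ t)) x
          - ((r+1) - (r+s+2) * x) * deriv (χ t) x
          - (m : ℝ) * (r+s+m+1) * χ t x) t := by
  refine ⟨fun x => by simp [hχ], fun t x => ?_⟩
  set e : ℕ → ℝ → ℝ := fun j τ => Real.exp (-((m : ℝ) - j) * (r + s + 1 + m + j) * τ) with he
  set P : ℝ[X] := ∑ j ∈ range (m + 1), C (c j * e j t) * jacobiQ r s j with hP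
  have hχt : χ t = fun y => P.eval y := by
    funext y
    simp [hχ, hP, he, eval_finsetSum]
  have h₁ : deriv (χ t) = fun y => (derivative P).eval y := by
    rw [hχt]; funext y; exact P.deriv
  have h₂ : deriv (deriv (χ t)) x = (derivative (derivative P)).eval x := by
    rw [h₁]; exact (derivative P).deriv
  have hderiv : HasDerivAt (fun τ => χ τ x) (∑ j ∈ range (m + 1),
      c j * (e j t * (-((m : ℝ) - j) * (r + s + 1 + m + j))) * (jacobiQ r s j).eval x) t := by
    simp only [hχ]
    refine HasDerivAt.fun_sum fun j _ => ?_
    have := ((hasDerivAt_id t).const_mul (-((m : ℝ) - j) * (r + s + 1 + m + j))).exp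
    simpa [he] using (this.const_mul (c j)).mul_const ((jacobiQ r s j).eval x)
  convert hderiv using 1
  rw [h₂, h₁, hχt]
  simp only [hP, derivative_sum, derivative_C_mul, eval_finsetSum, eval_mul, eval_C, mul_sum,
    ← sum_sub_distrib]
  refine sum_congr rfl fun j _ => ?_
  have h := congrArg (eval x) (jacobiQ_eigenfunction r s j)
  simp only [eval_add, eval_sub, eval_mul, eval_neg, eval_X, eval_one, eval_C] at h
  linear_combination (-(c j * e j t)) * h
end

section
/- Let m ≥ 1, let I ⊆ ℝ be an open interval, and let θ_1, …, θ_m : I → (0,π) be differentiable functions with pairwise distinct values; extend the family by setting θ_{2m+1−j}(t) := 2π − θ_j(t) for 1 ≤ j ≤ m. Assume that for every j ∈ {1,…,m} and t ∈ I: θ_j'(t) = (1/2) ∑_{k=1, k≠j}^{2m} cot( (θ_j(t) − θ_k(t))/2 ) (all cotangent arguments have nonzero sine under the stated hypotheses). Then the functions x_j(t) := cos²( θ_j(2t)/2 ), 1 ≤ j ≤ m, defined for those t with 2t ∈ I, solve the frozen Jacobi system with parameters p = q = m − 1/2; that is, x_j'(t) = (m − 1/2) − (2m−1) x_j(t) +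 ∑_{k≠j, 1≤k≤m} [x_j(t)(1−x_k(t)) + x_k(t)(1−x_j(t))]/(x_j(t) − x_k(t)). -/
open Finset

/-- Folding a sum over `1, …, 2m` along the reflection `k ↦ 2m + 1 - k`. -/
lemma sum_Icc_two_mul_eq_sum_add_reflect {M : Type*} [AddCommMonoid M] (m : ℕ) (f : ℕ → M) :
    ∑ k ∈ Icc 1 (2 * m), f k = ∑ k ∈ Icc 1 m, (f k + f (2 * m + 1 - k)) := by
  have hunion : Icc 1 (2 * m) = Icc 1 m ∪ Icc (m + 1) (2 * m) := by
    ext k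
    simp only [mem_union, mem_Icc]
    omega
  have hdisj : Disjoint (Icc 1 m) (Icc (m + 1) (2 * m)) := by
    rw [Finset.disjoint_left]
    intro k
    simp only [mem_Icc]
    omega
  rw [hunion, sum_union hdisj, sum_add_distrib]
  congr 1
  refine sum_nbij' (fun k => 2 * m + 1 - k) (fun k => 2 * m + 1 - k) ?_ ?_ ?_ ?_ ?_
  · intro k; simp only [mem_Icc]; omega
  · intro k; simp only [mem_Icc]; omega
  · intro k; simp only [mem_Icc]; omega
  · intro k; simp only [mem_Icc]; omega
  · intro k hk
    simp only [mem_Icc] at hk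
    congr 1
    omega

lemma Real.cot_sub_pi (a : ℝ) : Real.cot (a - Real.pi) = Real.cot a := by
  rw [Real.cot_eq_cos_div_sin, Real.cot_eq_cos_div_sin, Real.cos_sub_pi, Real.sin_sub_pi,
    neg_div_neg_eq]

/-- The interaction of an angle with another one and its conjugate, in the variables
`cos² (a / 2)` and `cos² (b / 2)`. -/
lemma neg_sin_mul_half_cot_add_cot {a b : ℝ} (ha : a ∈ Set.Ioo 0 Real.pi)
    (hb : b ∈ Set.Ioo 0 Real.pi) (hab : a ≠ b) :
    -Real.sin a * (1 / 2 *
        (Real.cot ((a - b) / 2) + Real.cot ((a - (2 * Real.pi - b)) / 2))) =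
      1 - 2 * Real.cos (a / 2) ^ 2 +
        (Real.cos (a / 2) ^ 2 * (1 - Real.cos (b / 2) ^ 2) +
            Real.cos (b / 2) ^ 2 * (1 - Real.cos (a / 2) ^ 2)) /
          (Real.cos (a / 2) ^ 2 - Real.cos (b / 2) ^ 2) := by
  obtain ⟨ha0, ha1⟩ := ha
  obtain ⟨hb0, hb1⟩ := hb
  have hadd : Real.sin ((a + b) / 2) ≠ 0 :=
    (Real.sin_pos_of_pos_of_lt_pi (by linarith) (by linarith)).ne'
  have hsub : Real.sin ((a - b) / 2) ≠ 0 := by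
    intro h
    rw [Real.sin_eq_zero_iff_of_lt_of_lt (by linarith) (by linarith)] at h
    exact hab (by linarith)
  have hshift : (a - (2 * Real.pi - b)) / 2 = (a + b) / 2 - Real.pi := by ring
  have hdiff : Real.cos (a / 2) ^ 2 - Real.cos (b / 2) ^ 2 =
      -(Real.sin ((a + b) / 2) * Real.sin ((a - b) / 2)) := by
    have ea : (a + b) / 2 = a / 2 + b / 2 := by ring
    have es : (a - b) / 2 = a / 2 - b / 2 := by ring
    rw [ea, es, Real.sin_add, Real.sin_sub]
    linear_combination (Real.cos (a / 2) ^ 2) * Real.sin_sq_add_cos_sq (b / 2) * (-1)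
      + (Real.cos (b / 2) ^ 2) * Real.sin_sq_add_cos_sq (a / 2)
  have hsum : Real.cot ((a - b) / 2) + Real.cot ((a + b) / 2) =
      Real.sin a / (Real.sin ((a + b) / 2) * Real.sin ((a - b) / 2)) := by
    have e : Real.sin a = Real.sin ((a + b) / 2 + (a - b) / 2) := by ring_nf
    rw [e, Real.sin_add, Real.cot_eq_cos_div_sin, Real.cot_eq_cos_div_sin]
    field_simp
  have hne : Real.cos (a / 2) ^ 2 - Real.cos (b / 2) ^ 2 ≠ 0 := by
    rw [hdiff]
    exact neg_ne_zero.mpr (mul_ne_zero hadd hsub)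
  have hprod : Real.sin ((a + b) / 2) * Real.sin ((a - b) / 2) =
      -(Real.cos (a / 2) ^ 2 - Real.cos (b / 2) ^ 2) := by linarith
  have hsq : Real.sin a ^ 2 = 4 * Real.cos (a / 2) ^ 2 * (1 - Real.cos (a / 2) ^ 2) := by
    have e : Real.sin a = 2 * Real.sin (a / 2) * Real.cos (a / 2) := by
      rw [← Real.sin_two_mul]
      ring_nf
    rw [e, ← Real.sin_sq]
    ring
  rw [hshift, Real.cot_sub_pi, hsum, hprod]
  field_simp
  linear_combination hsq

/-- The interaction of an angle with its own conjugate. -/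
lemma neg_sin_mul_half_cot_self {a : ℝ} (ha : a ∈ Set.Ioo 0 Real.pi) :
    -Real.sin a * (1 / 2 * Real.cot ((a - (2 * Real.pi - a)) / 2)) =
      1 / 2 - Real.cos (a / 2) ^ 2 := by
  have hsin : Real.sin a ≠ 0 := (Real.sin_pos_of_mem_Ioo ha).ne'
  have hshift : (a - (2 * Real.pi - a)) / 2 = a - Real.pi := by ring
  have hcos : Real.cos a = 2 * Real.cos (a / 2) ^ 2 - 1 := by
    rw [← Real.cos_two_mul]
    ring_nf
  rw [hshift, Real.cot_sub_pi, Real.cot_eq_cos_div_sin]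
  field_simp
  linarith

/-- **From the angular dynamics of the Hermite unitary polynomial to the frozen Jacobi
system with `p = q = m − 1/2`:** if `θ_1, …, θ_m : I → (0,π)` have pairwise distinct values,
are extended by `θ_{2m+1−j} = 2π − θ_j`, and satisfy
`θ_j' = (1/2)∑_{k≠j, 1≤k≤2m} cot((θ_j−θ_k)/2)`, then the functions
`x_j(t) = cos²(θ_j(2t)/2)` solve
`x_j' = (m−1/2) − (2m−1)x_j + ∑_{k≠j,1≤k≤m}[x_j(1−x_k)+x_k(1−x_j)]/(x_j−x_k)`. -/
theorem stmt_12 (m : ℕ) (hm : 1 ≤ m) (I : Set ℝ) (hI : IsOpen I) (hIint : I.OrdConnected)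
    (θ : ℕ → ℝ → ℝ)
    (hdiffθ : ∀ j ∈ Finset.Icc 1 m, ∀ t ∈ I, DifferentiableAt ℝ (θ j) t)
    (hrange : ∀ j ∈ Finset.Icc 1 m, ∀ t ∈ I, θ j t ∈ Set.Ioo 0 Real.pi)
    (hdist : ∀ t ∈ I, ∀ j ∈ Finset.Icc 1 m, ∀ k ∈ Finset.Icc 1 m, j ≠ k → θ j t ≠ θ k t)
    (hext : ∀ j ∈ Finset.Icc 1 m, ∀ t : ℝ, θ (2*m+1-j) t = 2*Real.pi - θ j t)
    (hode : ∀ j ∈ Finset.Icc 1 m, ∀ t ∈ I,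
      HasDerivAt (θ j)
        ((1/2) * ∑ k ∈ (Finset.Icc 1 (2*m)).erase j, Real.cot ((θ j t - θ k t)/2)) t)
    (x : ℕ → ℝ → ℝ)
    (hx : ∀ j : ℕ, ∀ t : ℝ, x j t = Real.cos (θ j (2*t) / 2)^2) :
    ∀ j ∈ Finset.Icc 1 m, ∀ t : ℝ, 2*t ∈ I →
      HasDerivAt (x j)
        (((m : ℝ) - 1/2) - (2*(m : ℝ) - 1) * x j t
          + ∑ k ∈ (Finset.Icc 1 m).erase j,
              (x j t * (1 - x k t) + x k t * (1 - x j t)) / (x j t - x k t)) t := by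
  intro j hj t ht
  have hx' : x j = fun s => Real.cos (θ j (2 * s) / 2) ^ 2 := funext (hx j)
  have hderiv : HasDerivAt (x j) (-Real.sin (θ j (2 * t)) * (1 / 2 *
      ∑ k ∈ (Icc 1 (2 * m)).erase j, Real.cot ((θ j (2 * t) - θ k (2 * t)) / 2))) t := by
    have hscale : HasDerivAt (fun s : ℝ => 2 * s) 2 t := by
      simpa using (hasDerivAt_id t).const_mul 2
    have h := ((((hode j hj (2 * t) ht).comp t hscale).div_const 2).cos).pow 2
    rw [hx']
    refine h.congr_deriv ?_
    have e : Real.sin (θ j (2 * t)) =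
        2 * Real.sin (θ j (2 * t) / 2) * Real.cos (θ j (2 * t) / 2) := by
      rw [← Real.sin_two_mul]
      ring_nf
    rw [e]
    simp only [Function.comp_apply]
    push_cast
    ring
  refine hderiv.congr_deriv ?_
  have hself : Real.cot ((θ j (2 * t) - θ j (2 * t)) / 2) = 0 := by
    simp [Real.cot_eq_cos_div_sin]
  rw [sum_erase (f := fun k => Real.cot ((θ j (2 * t) - θ k (2 * t)) / 2)) _ hself,
    sum_Icc_two_mul_eq_sum_add_reflect, ← add_sum_erase _ _ hj, hself,
    zero_add, hext j hj, mul_add, mul_add, neg_sin_mul_half_cot_self (hrange j hj _ ht),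
    mul_sum, mul_sum]
  have hpair : ∀ k ∈ (Icc 1 m).erase j,
      -Real.sin (θ j (2 * t)) * (1 / 2 * (Real.cot ((θ j (2 * t) - θ k (2 * t)) / 2) +
        Real.cot ((θ j (2 * t) - θ (2 * m + 1 - k) (2 * t)) / 2))) =
      (1 - 2 * x j t) + (x j t * (1 - x k t) + x k t * (1 - x j t)) / (x j t - x k t) := by
    intro k hk
    obtain ⟨hkj, hk⟩ := mem_erase.mp hk
    rw [hext k hk, hx j, hx k]
    exact neg_sin_mul_half_cot_add_cot (hrange j hj _ ht) (hrange k hk _ ht)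
      (hdist _ ht j hj k hk hkj.symm)
  rw [sum_congr rfl hpair, sum_add_distrib, sum_const, card_erase_of_mem hj, Nat.card_Icc,
    Nat.add_sub_cancel, nsmul_eq_mul, Nat.cast_sub hm, ← hx j t]
  push_cast
  ring
end

section
/- Let m ≥ 1, let p, q ∈ ℝ, let I ⊆ ℝ be an open interval, and let x_1, …, x_m : I → ℝ be differentiable functions with pairwise distinct values solving the frozen Jacobi system with parameters (p,q). Define the moments m_ℓ(t) := (1/m) ∑_{j=1}^m x_j(t)^ℓ for ℓ ≥ 0 (so m_0 ≡ 1). Then for every ℓ ≥ 1 and every t ∈ I: m_ℓ'(t) = −ℓ(p+q−ℓ+1) m_ℓ(t) + ℓ(p−ℓ+1) m_{ℓ−1}(t) + mℓ ∑_{k=0}^{ℓ−2} ( m_k(t) − m_{k+1}(t) ) m_{ℓ−1−k}(t), where the sum is empty when ℓ = 1 (so that m_1'(t) = p − (p+q)m_1(t)). -/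
open Finset

/-- Pointwise divided-difference identity behind the symmetrised Jacobi interaction; on the
diagonal the quotient is `0` and the right-hand side is corrected accordingly. -/
lemma pow_sub_pow_mul_interaction (n : ℕ) (a b : ℝ) :
    (a ^ n - b ^ n) * ((a * (1 - b) + b * (1 - a)) / (a - b)) =
      ∑ k ∈ range n, (b ^ k - b ^ (k + 1)) * a ^ (n - k)
        + ∑ k ∈ range n, (a ^ k - a ^ (k + 1)) * b ^ (n - k)
        - if a = b then 2 * n * (a ^ n - a ^ (n + 1)) else 0 := by
  have hsum : ∀ u v : ℝ, ∑ k ∈ range n, (v ^ k - v ^ (k + 1)) * u ^ (n - k) =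
      u * (1 - v) * ∑ k ∈ range n, v ^ k * u ^ (n - 1 - k) := by
    intro u v
    rw [mul_sum]
    refine sum_congr rfl fun k hk => ?_
    have hk' : n - k = n - 1 - k + 1 := by have := mem_range.mp hk; omega
    rw [hk']
    ring
  split_ifs with h
  · subst h
    have hdiag : ∑ k ∈ range n, (a ^ k - a ^ (k + 1)) * a ^ (n - k) =
        n * (a ^ n - a ^ (n + 1)) := by
      rw [sum_congr rfl (g := fun _ => a ^ n - a ^ (n + 1)), sum_const, card_range, nsmul_eq_mul]
      intro k hk
      rw [← Nat.add_sub_of_le (mem_range.mp hk).le, Nat.add_sub_cancel_left]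
      ring
    rw [hdiag]
    ring
  · have hab : a - b ≠ 0 := sub_ne_zero.mpr h
    have h1 := geom_sum₂_mul a b n
    have h2 := geom_sum₂_mul b a n
    rw [hsum, hsum, sub_zero, mul_div_assoc', div_eq_iff hab]
    linear_combination (-b * (1 - a)) * h1 + (a * (1 - b)) * h2

/-- The Jacobi interaction tested against a power, in terms of power sums. -/
lemma sum_pow_mul_interaction {ι : Type*} [Fintype ι] [DecidableEq ι] (n : ℕ) (y : ι → ℝ)
    (hy : Function.Injective y) :
    ∑ j, y j ^ n * ∑ k ∈ univ.erase j,
        (y j * (1 - y k) + y k * (1 - y j)) / (y j - y k) =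
      ∑ k ∈ range n, (∑ j, y j ^ k - ∑ j, y j ^ (k + 1)) * ∑ j, y j ^ (n - k)
        - n * (∑ j, y j ^ n - ∑ j, y j ^ (n + 1)) := by
  set F : ι → ι → ℝ := fun j k => (y j * (1 - y k) + y k * (1 - y j)) / (y j - y k) with hF
  set H : ι → ι → ℝ := fun j k => ∑ i ∈ range n, (y k ^ i - y k ^ (i + 1)) * y j ^ (n - i) with hH
  have herase : ∀ j, ∑ k ∈ univ.erase j,
      (y j * (1 - y k) + y k * (1 - y j)) / (y j - y k) = ∑ k, F j k := fun j =>
    sum_erase (f := F j) _ (by simp [hF])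
  have hanti : ∀ j k, F j k = -F k j := by
    intro j k
    simp only [hF]
    rw [← neg_sub (y k) (y j), div_neg]
    ring
  have hswap : ∑ j, ∑ k, y j ^ n * F j k = -∑ j, ∑ k, y k ^ n * F j k := by
    rw [sum_comm]
    simp only [← sum_neg_distrib]
    refine sum_congr rfl fun j _ => sum_congr rfl fun k _ => ?_
    rw [hanti k j]
    ring
  have hdouble : ∑ j, ∑ k, (y j ^ n - y k ^ n) * F j k =
      2 * ∑ j, ∑ k, H j k - 2 * n * (∑ j, y j ^ n - ∑ j, y j ^ (n + 1)) := by
    have hpt : ∀ j k, (y j ^ n - y k ^ n) * F j k =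
        H j k + H k j - if j = k then 2 * n * (y j ^ n - y j ^ (n + 1)) else 0 := by
      intro j k
      simpa only [hy.eq_iff] using pow_sub_pow_mul_interaction n (y j) (y k)
    simp only [hpt, sum_sub_distrib, sum_add_distrib, sum_ite_eq, mem_univ, if_true, ← mul_sum]
    rw [sum_comm (f := fun j k => H k j)]
    ring
  have hprod : ∑ j, ∑ k, H j k =
      ∑ k ∈ range n, (∑ j, y j ^ k - ∑ j, y j ^ (k + 1)) * ∑ j, y j ^ (n - k) := by
    simp only [hH, ← sum_sub_distrib, sum_mul_sum]
    rw [sum_comm, sum_congr rfl fun k _ => sum_comm, sum_comm]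
  have hsplit : ∑ j, ∑ k, (y j ^ n - y k ^ n) * F j k =
      2 * ∑ j, y j ^ n * ∑ k, F j k := by
    simp only [sub_mul, sum_sub_distrib, ← mul_sum] at hswap ⊢
    linarith
  simp only [herase]
  linarith

/-- **Differential system for the moments of the frozen Jacobi process:**
if `x_1, …, x_m` solve the frozen Jacobi system with parameters `(p,q)` and
`m_ℓ(t) = (1/m)∑_j x_j(t)^ℓ`, then for every `ℓ ≥ 1`,
`m_ℓ' = −ℓ(p+q−ℓ+1)m_ℓ + ℓ(p−ℓ+1)m_{ℓ−1} + mℓ ∑_{k=0}^{ℓ−2}(m_k − m_{k+1})m_{ℓ−1−k}`. -/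
theorem stmt_13 (m : ℕ) (hm : 1 ≤ m) (p q : ℝ)
    (I : Set ℝ) (hI : IsOpen I) (hIint : I.OrdConnected)
    (x : Fin m → ℝ → ℝ)
    (hsol : SolvesFrozenJacobi m p q I x)
    (mo : ℕ → ℝ → ℝ)
    (hmo : ∀ ℓ : ℕ, ∀ t : ℝ, mo ℓ t = (1/(m : ℝ)) * ∑ j : Fin m, x j t ^ ℓ) :
    ∀ ℓ : ℕ, 1 ≤ ℓ → ∀ t ∈ I,
      HasDerivAt (mo ℓ)
        (-(ℓ : ℝ) * (p+q-ℓ+1) * mo ℓ t + (ℓ : ℝ) * (p-ℓ+1) * mo (ℓ-1) t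
          + (m : ℝ) * (ℓ : ℝ) * ∑ k ∈ range (ℓ-1), (mo k t - mo (k+1) t) * mo (ℓ-1-k) t) t := by
  intro ℓ hℓ t ht
  obtain ⟨n, rfl⟩ := Nat.exists_eq_add_of_le' hℓ
  obtain ⟨hne, hder⟩ := hsol
  have hm0 : (m : ℝ) ≠ 0 := by positivity
  have hinj : Function.Injective fun j => x j t := fun i j hij => by
    by_contra h
    exact hne t ht i j h hij
  have hmo_eq : mo (n + 1) = fun s => (1 / (m : ℝ)) * ∑ j, x j s ^ (n + 1) := funext (hmo _)
  have hint := sum_pow_mul_interaction n (fun j => x j t) hinj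
  rw [hmo_eq]
  refine ((HasDerivAt.fun_sum fun j _ => (hder j t ht).fun_pow (n + 1)).const_mul
    (1 / (m : ℝ))).congr_deriv ?_
  have hdrift : ∑ j, ((n + 1 : ℕ) : ℝ) * x j t ^ (n + 1 - 1) *
      (p - (p + q) * x j t + ∑ k ∈ univ.erase j,
        (x j t * (1 - x k t) + x k t * (1 - x j t)) / (x j t - x k t)) =
      (n + 1) * (p * ∑ j, x j t ^ n - (p + q) * ∑ j, x j t ^ (n + 1)
        + ∑ j, x j t ^ n * ∑ k ∈ univ.erase j,
          (x j t * (1 - x k t) + x k t * (1 - x j t)) / (x j t - x k t)) := by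
    rw [mul_sum, mul_sum, ← sum_sub_distrib, ← sum_add_distrib, mul_sum]
    refine sum_congr rfl fun j _ => ?_
    rw [Nat.add_sub_cancel]
    push_cast
    ring
  have hquad : ∑ k ∈ range n, (mo k t - mo (k + 1) t) * mo (n - k) t =
      (1 / (m : ℝ)) ^ 2 * ∑ k ∈ range n,
        (∑ j, x j t ^ k - ∑ j, x j t ^ (k + 1)) * ∑ j, x j t ^ (n - k) := by
    rw [mul_sum]
    refine sum_congr rfl fun k _ => ?_
    rw [hmo, hmo, hmo]
    ring
  rw [hdrift, hint, Nat.add_sub_cancel, hquad, hmo n]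
  push_cast
  field_simp
  ring
end

section
/- Let m ≥ 1, let r, s ∈ ℝ and set p = r+m, q = s+m. Let I ⊆ ℝ be an open interval and let e_0, e_1, …, e_m : I → ℝ be differentiable functions with e_0 ≡ 1; define χ(t,x) := ∑_{n=0}^m (−1)^n e_n(t) x^{m−n}. Assume that for all t ∈ I and x ∈ ℝ: ∂_t χ(t,x) = −x(1−x) ∂²_x χ(t,x) − [(r+1) − (r+s+2)x] ∂_x χ(t,x) − m(r+s+m+1) χ(t,x). Then for every n ∈ {1,…,m} and every t ∈ I: e_n'(t) = −n(p+q−n+1) e_n(t) + (m−n+1)(p−n+1) e_{n−1}(t). -/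
open Finset

open Polynomial in
theorem coeff_X_mul_derivative {R : Type*} [CommSemiring R] (P : R[X]) (k : ℕ) :
    (X * derivative P).coeff k = k * P.coeff k := by
  cases k with
  | zero => simp
  | succ k => rw [coeff_X_mul, coeff_derivative]; push_cast; ring

open Polynomial in
theorem coeff_sum_C_mul_X_pow_sub {R : Type*} [Semiring R] (m : ℕ) (a : ℕ → R) {n : ℕ}
    (hn : n ≤ m) :
    (∑ i ∈ range (m + 1), C (a i) * X ^ (m - i)).coeff (m - n) = a n := by
  rw [finsetSum_coeff, Finset.sum_eq_single n]
  · simp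
  · intro i hi hin
    rw [Finset.mem_range] at hi
    rw [coeff_C_mul_X_pow, if_neg (by omega)]
  · intro h
    exact absurd (Finset.mem_range.2 (by omega)) h

open Polynomial in
/-- The coefficients of the operator `f ↦ x(1-x)f'' + (a - bx)f' + cf`, with the opposite sign. -/
theorem coeff_neg_hypergeometric {R : Type*} [CommRing R] (P : R[X]) (a b c : R) (k : ℕ) :
    (-(X * (1 - X)) * derivative (derivative P) - (C a - C b * X) * derivative P
        - C c * P).coeff k
      = (k * (k - 1) + b * k - c) * P.coeff k - (k + 1) * (k + a) * P.coeff (k + 1) := by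
  have h : -(X * (1 - X)) * derivative (derivative P) - (C a - C b * X) * derivative P - C c * P
      = X * derivative (X * derivative P) - X * derivative P - X * derivative (derivative P)
        - C a * derivative P + C b * (X * derivative P) - C c * P := by
    rw [derivative_mul, derivative_X]
    ring
  rw [h]
  simp only [coeff_sub, coeff_add, coeff_C_mul, coeff_X_mul_derivative, coeff_derivative]
  ring

/-- **From the inverse Jacobi-heat equation to the differential system for the elementary
symmetric functions:** if `χ(t,x) = ∑_{n=0}^m (−1)^n e_n(t) x^{m−n}` with `e_0 ≡ 1` solves
`∂_t χ = −x(1−x)∂²_x χ − [(r+1)−(r+s+2)x]∂_x χ − m(r+s+m+1)χ` on `I`, then for `1 ≤ n ≤ m`,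
`e_n' = −n(p+q−n+1)e_n + (m−n+1)(p−n+1)e_{n−1}` with `p = r+m`, `q = s+m`. -/
theorem stmt_16 (m : ℕ) (hm : 1 ≤ m) (r s : ℝ) (p q : ℝ) (hp : p = r + m) (hq : q = s + m)
    (I : Set ℝ) (hI : IsOpen I)
    (e : ℕ → ℝ → ℝ) (he0 : ∀ t, e 0 t = 1)
    (hediff : ∀ n ≤ m, ∀ t ∈ I, DifferentiableAt ℝ (e n) t)
    (χ : ℝ → ℝ → ℝ)
    (hχ : ∀ t x, χ t x = ∑ n ∈ range (m+1), (-1:ℝ)^n * e n t * x^(m-n))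
    (hPDE : ∀ t ∈ I, ∀ x : ℝ,
      HasDerivAt (fun τ => χ τ x)
        (-(x * (1 - x)) * deriv (deriv (χ t)) x
          - ((r+1) - (r+s+2) * x) * deriv (χ t) x
          - (m : ℝ) * (r+s+m+1) * χ t x) t) :
    ∀ n ∈ Finset.Icc 1 m, ∀ t ∈ I,
      HasDerivAt (e n)
        (-(n : ℝ) * (p+q-n+1) * e n t + ((m : ℝ)-n+1) * (p-n+1) * e (n-1) t) t := by
  intro n hn t ht
  obtain ⟨hn1, hnm⟩ := Finset.mem_Icc.1 hn
  set P : Polynomial ℝ := ∑ i ∈ range (m + 1),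
    Polynomial.C ((-1 : ℝ) ^ i * e i t) * Polynomial.X ^ (m - i) with hP
  set Q : Polynomial ℝ := ∑ i ∈ range (m + 1),
    Polynomial.C ((-1 : ℝ) ^ i * deriv (e i) t) * Polynomial.X ^ (m - i) with hQ
  have hχP : χ t = fun x => P.eval x := by
    funext x
    simp [hχ, hP, Polynomial.eval_finsetSum]
  have hd : deriv (χ t) = fun x => P.derivative.eval x := by
    funext x
    rw [hχP, Polynomial.deriv]
  have hdd : deriv (deriv (χ t)) = fun x => P.derivative.derivative.eval x := by
    funext x
    rw [hd, Polynomial.deriv]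
  have hQP : Q = -(Polynomial.X * (1 - Polynomial.X)) * P.derivative.derivative
      - (Polynomial.C (r + 1) - Polynomial.C (r + s + 2) * Polynomial.X) * P.derivative
      - Polynomial.C ((m : ℝ) * (r + s + m + 1)) * P := by
    refine Polynomial.funext fun x => ?_
    have hpde := hPDE t ht x
    rw [hdd, hd, hχP] at hpde
    have hsum : HasDerivAt (fun τ => χ τ x) (Q.eval x) t := by
      simp only [hχ, hQ, Polynomial.eval_finsetSum, Polynomial.eval_mul, Polynomial.eval_C,
        Polynomial.eval_pow, Polynomial.eval_X]
      refine HasDerivAt.fun_sum fun i hi => ?_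
      have hi' : i ≤ m := Nat.lt_succ_iff.1 (Finset.mem_range.1 hi)
      exact ((hediff i hi' t ht).hasDerivAt.const_mul _).mul_const _
    rw [hsum.unique hpde]
    simp
  have hcoeff := congrArg (fun F => Polynomial.coeff F (m - n)) hQP
  simp only [coeff_neg_hypergeometric] at hcoeff
  rw [show m - n + 1 = m - (n - 1) by omega, hQ, hP,
    coeff_sum_C_mul_X_pow_sub m _ hnm, coeff_sum_C_mul_X_pow_sub m _ hnm,
    coeff_sum_C_mul_X_pow_sub m _ (by omega : n - 1 ≤ m), Nat.cast_sub hnm] at hcoeff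
  obtain ⟨k, rfl⟩ : ∃ k, n = k + 1 := ⟨n - 1, by omega⟩
  have hderiv := (hediff (k + 1) hnm t ht).hasDerivAt
  refine hderiv.congr_deriv ?_
  refine mul_left_cancel₀ (pow_ne_zero (k + 1) (by norm_num : (-1 : ℝ) ≠ 0)) ?_
  rw [hcoeff, hp, hq, Nat.add_sub_cancel]
  push_cast
  ring
end

section
/- Let m ≥ 1, p, q ∈ ℝ, and fix n with 2 ≤ n ≤ m. Let I ⊆ ℝ be an open interval and let e_{n−2}, e_{n−1}, e_n : I → ℝ be differentiable with e_{n−2}(t) ≠ 0 and e_{n−1}(t) ≠ 0 for all t ∈ I, satisfying e_k'(t) = −k(p+q−k+1) e_k(t) + (m−k+1)(p−k+1) e_{k−1}(t) for k ∈ {n−1, n}. Define T_n(t) := (n/(m−n+1)) · e_n(t)/e_{n−1}(t) and T_{n−1}(t) := ((n−1)/(m−n+2)) · e_{n−1}(t)/e_{n−2}(t). Then for all t ∈ I: T_n'(t) = [2(n−1) − (p+q)] T_n(t) + p − 2(n−1) + (n−1)(p−n+2) · ( T_{n−1}(t) − T_n(t) ) / T_{n−1}(t). -/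
/-- **Differential-difference equation for the finite free T transform of the frozen Jacobi
process:** if `e_k' = −k(p+q−k+1)e_k + (m−k+1)(p−k+1)e_{k−1}` for `k ∈ {n−1, n}`, with
`T_n = (n/(m−n+1)) e_n/e_{n−1}` and `T_{n−1} = ((n−1)/(m−n+2)) e_{n−1}/e_{n−2}`, then
`T_n' = [2(n−1) − (p+q)]T_n + p − 2(n−1) + (n−1)(p−n+2)(T_{n−1} − T_n)/T_{n−1}`. -/
theorem stmt_17 (m : ℕ) (hm : 1 ≤ m) (p q : ℝ) (n : ℕ) (hn : 2 ≤ n) (hnm : n ≤ m)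
    (I : Set ℝ) (hI : IsOpen I)
    (e : ℕ → ℝ → ℝ)
    (hne2 : ∀ t ∈ I, e (n-2) t ≠ 0) (hne1 : ∀ t ∈ I, e (n-1) t ≠ 0)
    (hode : ∀ k ∈ ({n-1, n} : Finset ℕ), ∀ t ∈ I,
      HasDerivAt (e k)
        (-(k : ℝ) * (p+q-k+1) * e k t + ((m : ℝ)-k+1) * (p-k+1) * e (k-1) t) t)
    (Tn Tn1 : ℝ → ℝ)
    (hTn : ∀ t, Tn t = ((n : ℝ)/((m : ℝ)-n+1)) * (e n t / e (n-1) t))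
    (hTn1 : ∀ t, Tn1 t = (((n : ℝ)-1)/((m : ℝ)-n+2)) * (e (n-1) t / e (n-2) t)) :
    ∀ t ∈ I,
      HasDerivAt Tn
        ((2*((n : ℝ)-1) - (p+q)) * Tn t + p - 2*((n : ℝ)-1)
          + ((n : ℝ)-1) * (p-(n : ℝ)+2) * (Tn1 t - Tn t) / Tn1 t) t := by
  intro t ht
  obtain ⟨j, rfl⟩ := Nat.exists_eq_add_of_le' hn
  obtain ⟨l, rfl⟩ := Nat.exists_eq_add_of_le hnm
  simp only [show j + 2 - 1 = j + 1 from rfl, show j + 2 - 2 = j from rfl] at *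
  have hn1 := hode (j + 1) (by simp) t ht
  have hn0 := hode (j + 2) (by simp) t ht
  simp only [show j + 2 - 1 = j + 1 from rfl, show j + 1 - 1 = j from rfl] at hn0 hn1
  have hd := hne2 t ht
  have hb := hne1 t ht
  have hj : (j : ℝ) + 1 ≠ 0 := by positivity
  have hl1 : (l : ℝ) + 1 ≠ 0 := by positivity
  have hl2 : (l : ℝ) + 2 ≠ 0 := by positivity
  rw [funext hTn, hTn1]
  refine ((hn0.div hn1 hb).const_mul _).congr_deriv ?_
  push_cast
  rw [show (j : ℝ) + 2 + l - (j + 2) + 1 = l + 1 by ring,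
    show (j : ℝ) + 2 + l - (j + 2) + 2 = l + 2 by ring,
    show (j : ℝ) + 2 + l - (j + 1) + 1 = l + 2 by ring,
    show (j : ℝ) + 2 - 1 = j + 1 by ring]
  field_simp
  ring
end

section
/- Let λ, θ ∈ (0,1], let V ⊆ ℂ be an open set, and let G : [0,∞) × V → ℂ be such that G(t,·) is holomorphic on V for each t ≥ 0, ∂_t G exists, and for all t ≥ 0 and w ∈ V: ∂_t G(t,w) = ∂_w{ [(1−2λθ)w − θ(1−λ)] G(t,w) + λθ w(w−1) G(t,w)² }. Let U := {z ∈ ℂ : z ≠ 0 and 1/z ∈ V} and define M(t,z) := (1/z) G(t, 1/z). Then for all t ≥ 0 and z ∈ U: ∂_t M(t,z) = −z ∂_z{ [(1−2λθ) − θ(1−λ)z] M(t,z) + λθ(1−z) M(t,z)² }. -/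
/-- **PDE for the moment generating function of the free Jacobi process:** if the Cauchy
transform `G` satisfies `∂_t G = ∂_w{[(1−2λθ)w − θ(1−λ)]G + λθw(w−1)G²}` on `V`, then
`M(t,z) = (1/z)G(t,1/z)` satisfies
`∂_t M = −z∂_z{[(1−2λθ) − θ(1−λ)z]M + λθ(1−z)M²}` on `U = {z ≠ 0 : 1/z ∈ V}`. -/
theorem stmt_19 (lam th : ℝ) (hlam : lam ∈ Set.Ioc (0:ℝ) 1) (hth : th ∈ Set.Ioc (0:ℝ) 1)
    (V : Set ℂ) (hV : IsOpen V)
    (G : ℝ → ℂ → ℂ)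
    (hGhol : ∀ t : ℝ, 0 ≤ t → DifferentiableOn ℂ (G t) V)
    (hPDE : ∀ t : ℝ, 0 ≤ t → ∀ w ∈ V,
      HasDerivWithinAt (fun s => G s w)
        (deriv (fun w' => ((1 - 2*(lam:ℂ)*(th:ℂ))*w' - (th:ℂ)*(1-(lam:ℂ))) * G t w'
            + (lam:ℂ)*(th:ℂ)*w'*(w'-1) * (G t w')^2) w)
        (Set.Ici 0) t)
    (U : Set ℂ) (hU : U = {z : ℂ | z ≠ 0 ∧ z⁻¹ ∈ V})
    (M : ℝ → ℂ → ℂ) (hM : ∀ t z, M t z = z⁻¹ * G t z⁻¹) :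
    ∀ t : ℝ, 0 ≤ t → ∀ z ∈ U,
      HasDerivWithinAt (fun s => M s z)
        (-z * deriv (fun z' => ((1 - 2*(lam:ℂ)*(th:ℂ)) - (th:ℂ)*(1-(lam:ℂ))*z') * M t z'
            + (lam:ℂ)*(th:ℂ)*(1-z') * (M t z')^2) z)
        (Set.Ici 0) t := by
  intro t ht z hz
  rw [hU] at hz
  obtain ⟨hz0, hzV⟩ := hz
  set F : ℂ → ℂ := fun w' => ((1 - 2*(lam:ℂ)*(th:ℂ))*w' - (th:ℂ)*(1-(lam:ℂ))) * G t w'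
            + (lam:ℂ)*(th:ℂ)*w'*(w'-1) * (G t w')^2 with hF
  have hG : DifferentiableAt ℂ (G t) z⁻¹ := (hGhol t ht).differentiableAt (hV.mem_nhds hzV)
  have hFd : DifferentiableAt ℂ F z⁻¹ := by fun_prop
  have hFz : HasDerivAt (fun z' => F z'⁻¹) (deriv F z⁻¹ * -(z ^ 2)⁻¹) z :=
    hFd.hasDerivAt.comp z (hasDerivAt_inv hz0)
  have heq : (fun z' => ((1 - 2*(lam:ℂ)*(th:ℂ)) - (th:ℂ)*(1-(lam:ℂ))*z') * M t z'
      + (lam:ℂ)*(th:ℂ)*(1-z') * (M t z')^2) =ᶠ[nhds z] fun z' => F z'⁻¹ := by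
    filter_upwards [isOpen_ne.mem_nhds hz0] with x (hx : x ≠ 0)
    simp only [hM, hF]
    field_simp
  rw [heq.deriv_eq, hFz.deriv]
  simp only [hM]
  have hcoef : -z * (deriv F z⁻¹ * -(z ^ 2)⁻¹) = z⁻¹ * deriv F z⁻¹ := by
    field_simp
  rw [hcoef]
  exact (hPDE t ht z⁻¹ hzV).const_mul z⁻¹
end
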